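/- arXiv:2103.07273 — 2 statements merged into one kernel-verified Lean document; each statement's English description precedes it below -/
import Mathlib

section
/- Under the standing assumptions, the domain Markov decomposition is unique: if for some a + r𝔹 ⊆ 𝔹 there are two decompositions (h^𝔹, f) = (h, f) + (φ, f) = (h̃, f) + (φ̃, f) for all f ∈ C_c^∞(ℝ^d), each satisfying the requirements of assumption (4) (independence of the summands, copy of h^{a+r𝔹} in law, a.s. harmonic restriction to a + r𝔹), then almost surely the harmonic functions φ and φ̃ coincide on a + r𝔹, and consequently (h, f) = (h̃, f) a.s. for every f supported in a + r𝔹. -/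
open MeasureTheory ProbabilityTheory Metric Filter Topology Set

noncomputable section

abbrev Euc (d : ℕ) : Type := EuclideanSpace ℝ (Fin d)

/-- The scaling function `s`: `s(r) = -log r` if `d = 2`, and `s(r) = r^(2-d)` if `d ≥ 3`. -/
noncomputable def sFun (d : ℕ) (r : ℝ) : ℝ :=
  if d = 2 then -Real.log r else r ^ ((2 : ℝ) - (d : ℝ))

open Classical in
/-- The zero boundary Green's function of the open unit ball in `ℝ^d`:
`G(x,y) = s(|x-y|) - s(|x|·|y - x/|x|²|)`, interpreted by continuity at `x = 0`. -/
noncomputable def greenBall (d : ℕ) (x y : Euc d) : ℝ :=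
  if x = 0 then sFun d ‖y‖ - sFun d 1
  else sFun d ‖x - y‖ - sFun d (‖x‖ * ‖y - (‖x‖ ^ 2)⁻¹ • x‖)

/-- Smooth compactly supported test functions. -/
def IsTestFun {d : ℕ} (f : Euc d → ℝ) : Prop :=
  ContDiff ℝ (⊤ : ℕ∞) f ∧ HasCompactSupport f

/-- The Laplacian of `u : ℝ^d → ℝ` at `x`, as the sum of pure second derivatives in the
coordinate directions. -/
noncomputable def lap {d : ℕ} (u : Euc d → ℝ) (x : Euc d) : ℝ :=
  ∑ i : Fin d, iteratedFDeriv ℝ 2 u x ![EuclideanSpace.single i 1, EuclideanSpace.single i 1]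

/-- A function is harmonic on a set if it is twice continuously differentiable there with
vanishing Laplacian. -/
def IsHarmonicOn {d : ℕ} (u : Euc d → ℝ) (s : Set (Euc d)) : Prop :=
  ContDiffOn ℝ 2 u s ∧ ∀ x ∈ s, lap u x = 0

/-- A real random variable is a (possibly degenerate) centered Gaussian. -/
def IsCenteredGaussianRV {Ω : Type} [MeasurableSpace Ω] (P : Measure Ω) (Y : Ω → ℝ) : Prop :=
  ∃ v : NNReal, Measure.map Y P = ProbabilityTheory.gaussianReal 0 v

/-- The standing assumptions: a collection of stochastic processes `h a r` (thought of as
`h^{a + r𝔹}`) indexed by test functions, which is centered, a.s. linear, zero outside the ball,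
translation/scaling covariant, satisfies the domain Markov property (with the decomposition
recorded as data `H`, `Φ`, `φharm`), has fourth moments, a (sequentially) continuous covariance
bilinear form on `C_c^∞(𝔹)`, and zero boundary conditions. -/
structure GFF (d : ℕ) (Ω : Type) [MeasurableSpace Ω] where
  P : Measure Ω
  prob : IsProbabilityMeasure P
  /-- the field `h^{a+r𝔹}` tested against `f` -/
  h : Euc d → ℝ → (Euc d → ℝ) → Ω → ℝ
  meas_h : ∀ a r f, Measurable (h a r f)
  integrable_h : ∀ a r f, IsTestFun f → Integrable (h a r f) P
  /-- centered -/
  centered : ∀ a r f, IsTestFun f → ∫ ω, h a r f ω ∂P = 0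
  /-- (1) a.s. linearity in the test function -/
  lin_add : ∀ f g : Euc d → ℝ, IsTestFun f → IsTestFun g →
    ∀ᵐ ω ∂P, h 0 1 (f + g) ω = h 0 1 f ω + h 0 1 g ω
  lin_smul : ∀ (c : ℝ) (f : Euc d → ℝ), IsTestFun f →
    ∀ᵐ ω ∂P, h 0 1 (c • f) ω = c * h 0 1 f ω
  /-- (2) the field vanishes on test functions supported outside the ball -/
  zero_outside : ∀ f : Euc d → ℝ, IsTestFun f → tsupport f ⊆ (ball (0 : Euc d) 1)ᶜ →
    ∀ᵐ ω ∂P, h 0 1 f ω = 0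
  /-- (3) translation and scaling: `(h^{a+r𝔹}, f((·-a)/r)) = r^{1+d/2} (h^𝔹, f)` in law,
  as processes (equality of finite dimensional distributions) -/
  scaling : ∀ (a : Euc d) (r : ℝ), 0 < r → ∀ (k : ℕ) (f : Fin k → Euc d → ℝ),
    (∀ i, IsTestFun (f i)) →
    Measure.map (fun ω (i : Fin k) => h a r (fun x => f i (r⁻¹ • (x - a))) ω) P
      = Measure.map (fun ω (i : Fin k) => r ^ (1 + (d : ℝ) / 2) * h 0 1 (f i) ω) P
  /-- (4) domain Markov property: the decomposition data. `H a r` is the independent copy of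
  `h^{a+r𝔹}`, `Φ a r` is the harmonic part as a process, `φharm a r ω` is the harmonic function. -/
  H : Euc d → ℝ → (Euc d → ℝ) → Ω → ℝ
  Φ : Euc d → ℝ → (Euc d → ℝ) → Ω → ℝ
  φharm : Euc d → ℝ → Ω → Euc d → ℝ
  meas_H : ∀ a r f, Measurable (H a r f)
  meas_Φ : ∀ a r f, Measurable (Φ a r f)
  meas_φharm : ∀ a r z, Measurable fun ω => φharm a r ω z
  dmp_decomp : ∀ (a : Euc d) (r : ℝ), 0 < r → ball a r ⊆ ball (0 : Euc d) 1 →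
    ∀ f : Euc d → ℝ, IsTestFun f → ∀ᵐ ω ∂P, h 0 1 f ω = H a r f ω + Φ a r f ω
  dmp_indep : ∀ (a : Euc d) (r : ℝ), 0 < r → ball a r ⊆ ball (0 : Euc d) 1 →
    ProbabilityTheory.Indep
      (⨆ f : {f : Euc d → ℝ // IsTestFun f}, MeasurableSpace.comap (H a r f.1) inferInstance)
      ((⨆ f : {f : Euc d → ℝ // IsTestFun f}, MeasurableSpace.comap (Φ a r f.1) inferInstance) ⊔
        (⨆ z : Euc d, MeasurableSpace.comap (fun ω => φharm a r ω z) inferInstance)) P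
  dmp_law : ∀ (a : Euc d) (r : ℝ), 0 < r → ball a r ⊆ ball (0 : Euc d) 1 →
    ∀ (k : ℕ) (f : Fin k → Euc d → ℝ), (∀ i, IsTestFun (f i)) →
    Measure.map (fun ω (i : Fin k) => H a r (f i) ω) P
      = Measure.map (fun ω (i : Fin k) => h a r (f i) ω) P
  dmp_harm : ∀ (a : Euc d) (r : ℝ), 0 < r → ball a r ⊆ ball (0 : Euc d) 1 →
    ∀ᵐ ω ∂P, IsHarmonicOn (φharm a r ω) (ball a r) ∧
      ∀ f : Euc d → ℝ, IsTestFun f → tsupport f ⊆ ball a r →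
        Φ a r f ω = ∫ x in ball a r, φharm a r ω x * f x
  /-- (5) fourth moments -/
  mom4 : ∀ f : Euc d → ℝ, IsTestFun f → Integrable (fun ω => (h 0 1 f ω) ^ 4) P
  /-- (6) sequential continuity of the covariance bilinear form on `C_c^∞(𝔹)` -/
  K2_cont : ∀ (f : ℕ → Euc d → ℝ) (f₀ g : Euc d → ℝ) (K : Set (Euc d)),
    IsCompact K → K ⊆ ball (0 : Euc d) 1 →
    (∀ n, IsTestFun (f n)) → IsTestFun f₀ → IsTestFun g → tsupport g ⊆ ball (0 : Euc d) 1 →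
    (∀ n, tsupport (f n) ⊆ K) → tsupport f₀ ⊆ K →
    (∀ m : ℕ, TendstoUniformly (fun n => iteratedFDeriv ℝ m (f n)) (iteratedFDeriv ℝ m f₀) atTop) →
    Tendsto (fun n => ∫ ω, h 0 1 (f n) ω * h 0 1 g ω ∂P) atTop
      (𝓝 (∫ ω, h 0 1 f₀ ω * h 0 1 g ω ∂P))
  /-- (7) zero boundary conditions -/
  zero_bdry : ∀ f : ℕ → Euc d → ℝ,
    (∀ n, IsTestFun (f n)) → (∀ n x, 0 ≤ f n x) →
    (∃ C : ℝ, ∀ n, ∫ x, f n x ≤ C) →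
    Tendsto (fun n => Metric.infDist (0 : Euc d) (tsupport (f n))) atTop (𝓝 1) →
    (∃ C : ℝ, ∀ (n : ℕ) (x y : Euc d), ‖x‖ = ‖y‖ → ‖x‖ < 1 → f n x ≤ C * f n y) →
    Tendsto (fun n => ∫ ω, (h 0 1 (f n) ω) ^ 2 ∂P) atTop (𝓝 0)

instance {d : ℕ} {Ω : Type} [MeasurableSpace Ω] (X : GFF d Ω) : IsProbabilityMeasure X.P :=
  X.prob

/-- `(H, Φ, φ)` is a domain Markov decomposition of `h^𝔹` in the ball `a + r𝔹` in the sense of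
assumption (4): `h^𝔹 = H + Φ` with the summands independent, `H` a copy of `h^{a+r𝔹}` in law, and
`Φ` a.s. given by integration against the harmonic function `φ` on test functions supported in
`a + r𝔹`. -/
def IsDMPDecomp {d : ℕ} {Ω : Type} [MeasurableSpace Ω] (X : GFF d Ω) (a : Euc d) (r : ℝ)
    (H Φ : (Euc d → ℝ) → Ω → ℝ) (φ : Ω → Euc d → ℝ) : Prop :=
  (∀ f : Euc d → ℝ, Measurable (H f) ∧ Measurable (Φ f)) ∧
  (∀ z : Euc d, Measurable fun ω => φ ω z) ∧
  (∀ f : Euc d → ℝ, IsTestFun f → ∀ᵐ ω ∂X.P, X.h 0 1 f ω = H f ω + Φ f ω) ∧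
  ProbabilityTheory.Indep
    (⨆ f : {f : Euc d → ℝ // IsTestFun f}, MeasurableSpace.comap (H f.1) inferInstance)
    ((⨆ f : {f : Euc d → ℝ // IsTestFun f}, MeasurableSpace.comap (Φ f.1) inferInstance) ⊔
      (⨆ z : Euc d, MeasurableSpace.comap (fun ω => φ ω z) inferInstance)) X.P ∧
  (∀ (k : ℕ) (f : Fin k → Euc d → ℝ), (∀ i, IsTestFun (f i)) →
    Measure.map (fun ω (i : Fin k) => H (f i) ω) X.P
      = Measure.map (fun ω (i : Fin k) => X.h a r (f i) ω) X.P) ∧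
  (∀ᵐ ω ∂X.P, IsHarmonicOn (φ ω) (ball a r) ∧
    ∀ f : Euc d → ℝ, IsTestFun f → tsupport f ⊆ ball a r →
      Φ f ω = ∫ x in ball a r, φ ω x * f x)

/-! ### The Laplacian -/

lemma lap_eq_sum_fderiv_fderiv {d : ℕ} {u : Euc d → ℝ} {x : Euc d} (hu : ContDiffAt ℝ 2 u x) :
    lap u x = ∑ i : Fin d, fderiv ℝ (fun y => fderiv ℝ u y (EuclideanSpace.single i 1)) x
      (EuclideanSpace.single i 1) := by
  have hd : DifferentiableAt ℝ (fderiv ℝ u) x :=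
    (hu.fderiv_right (m := 1) (by norm_num)).differentiableAt (by norm_num)
  refine Finset.sum_congr rfl fun i _ => ?_
  rw [iteratedFDeriv_two_apply, fderiv_clm_apply hd (differentiableAt_const _)]
  simp

lemma lap_congr_of_eventuallyEq {d : ℕ} {u v : Euc d → ℝ} {x : Euc d} (h : u =ᶠ[𝓝 x] v) :
    lap u x = lap v x := by
  unfold lap
  rw [(h.iteratedFDeriv ℝ 2).eq_of_nhds]

lemma lap_eq_zero_of_eventuallyEq_zero {d : ℕ} {u : Euc d → ℝ} {x : Euc d}
    (h : u =ᶠ[𝓝 x] fun _ => 0) : lap u x = 0 := by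
  rw [lap_congr_of_eventuallyEq h]
  simp [lap]

lemma ContDiff.lap {d : ℕ} {u : Euc d → ℝ} (hu : ContDiff ℝ (⊤ : ℕ∞) u) :
    ContDiff ℝ (⊤ : ℕ∞) (lap u) := by
  have h : _root_.lap u = fun x => ∑ i : Fin d, fderiv ℝ
      (fun y => fderiv ℝ u y (EuclideanSpace.single i 1)) x (EuclideanSpace.single i 1) :=
    funext fun x => lap_eq_sum_fderiv_fderiv (contDiff_infty.1 hu 2).contDiffAt
  rw [h]
  refine ContDiff.sum fun i _ => ?_
  have h1 : ContDiff ℝ (⊤ : ℕ∞) (fun y => fderiv ℝ u y (EuclideanSpace.single i 1)) :=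
    (hu.fderiv_right (m := (⊤ : ℕ∞)) (by simp)).clm_apply contDiff_const
  exact (h1.fderiv_right (m := (⊤ : ℕ∞)) (by simp)).clm_apply contDiff_const

lemma tsupport_lap_subset {d : ℕ} (u : Euc d → ℝ) : tsupport (lap u) ⊆ tsupport u := by
  refine closure_minimal (fun x hx => ?_) (isClosed_tsupport u)
  by_contra hxu
  exact hx (lap_eq_zero_of_eventuallyEq_zero (notMem_tsupport_iff_eventuallyEq.1 hxu))

lemma IsTestFun.lap {d : ℕ} {u : Euc d → ℝ} (hu : IsTestFun u) : IsTestFun (lap u) :=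
  ⟨hu.1.lap, hu.2.mono' ((subset_tsupport _).trans (tsupport_lap_subset u))⟩

lemma lap_sub {d : ℕ} {u v : Euc d → ℝ} {x : Euc d} (hu : ContDiffAt ℝ 2 u x)
    (hv : ContDiffAt ℝ 2 v x) : lap (fun y => u y - v y) x = lap u x - lap v x := by
  have h : (fun y => u y - v y) = u - v := rfl
  simp only [lap, h, iteratedFDeriv_sub_apply hu hv, sub_apply,
    Finset.sum_sub_distrib]

lemma lap_mul {d : ℕ} {u v : Euc d → ℝ} {x : Euc d} (hu : ContDiff ℝ 2 u)
    (hv : ContDiff ℝ 2 v) : lap (fun y => u y * v y) x = u x * lap v x + v x * lap u x +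
      2 * ∑ i : Fin d, fderiv ℝ u x (EuclideanSpace.single i 1) *
        fderiv ℝ v x (EuclideanSpace.single i 1) := by
  have hu1 := hu.differentiable (by norm_num)
  have hv1 := hv.differentiable (by norm_num)
  have hu2 (e : Euc d) : Differentiable ℝ (fun y => fderiv ℝ u y e) :=
    ((hu.fderiv_right (m := 1) (by norm_num)).clm_apply contDiff_const).differentiable (by norm_num)
  have hv2 (e : Euc d) : Differentiable ℝ (fun y => fderiv ℝ v y e) :=
    ((hv.fderiv_right (m := 1) (by norm_num)).clm_apply contDiff_const).differentiable (by norm_num)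
  rw [lap_eq_sum_fderiv_fderiv (hu.mul hv).contDiffAt, lap_eq_sum_fderiv_fderiv hu.contDiffAt,
    lap_eq_sum_fderiv_fderiv hv.contDiffAt, Finset.mul_sum, Finset.mul_sum, Finset.mul_sum,
    ← Finset.sum_add_distrib, ← Finset.sum_add_distrib]
  refine Finset.sum_congr rfl fun i _ => ?_
  set e : Euc d := EuclideanSpace.single i 1
  have h1 : (fun y => fderiv ℝ (fun y => u y * v y) y e) =
      fun y => u y * fderiv ℝ v y e + v y * fderiv ℝ u y e := by
    funext y
    rw [fderiv_fun_mul (hu1 y) (hv1 y)]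
    simp
  rw [h1, fderiv_fun_add ((hu1 x).fun_mul (hv2 e x)) ((hv1 x).fun_mul (hu2 e x)),
    fderiv_fun_mul (hu1 x) (hv2 e x), fderiv_fun_mul (hv1 x) (hu2 e x)]
  simp
  ring

lemma lap_comp_homothety {d : ℕ} {u : Euc d → ℝ} (hu : ContDiff ℝ 2 u) (a x : Euc d) (c : ℝ) :
    lap (fun y => u (c • (y - a))) x = c ^ 2 * lap u (c • (x - a)) := by
  have hu2 (e : Euc d) : Differentiable ℝ (fun y => fderiv ℝ u y e) :=
    ((hu.fderiv_right (m := 1) (by norm_num)).clm_apply contDiff_const).differentiable (by norm_num)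
  have key (w : Euc d → ℝ) (hw : Differentiable ℝ w) (y e : Euc d) :
      fderiv ℝ (fun y => w (c • (y - a))) y e = c * fderiv ℝ w (c • (y - a)) e := by
    have h1 : HasFDerivAt (fun y => c • (y - a)) (c • ContinuousLinearMap.id ℝ (Euc d)) y :=
      ((hasFDerivAt_id y).sub_const a).const_smul c
    have h2 := (hw (c • (y - a))).hasFDerivAt.comp y h1
    have h3 : fderiv ℝ (fun y => w (c • (y - a))) y = _ := h2.fderiv
    rw [h3]
    simp
  have hcomp : ContDiff ℝ 2 (fun y => u (c • (y - a))) :=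
    hu.comp ((contDiff_id.sub contDiff_const).const_smul c)
  rw [lap_eq_sum_fderiv_fderiv hcomp.contDiffAt, lap_eq_sum_fderiv_fderiv hu.contDiffAt,
    Finset.mul_sum]
  refine Finset.sum_congr rfl fun i _ => ?_
  simp only [key u (hu.differentiable (by norm_num))]
  rw [fderiv_const_mul]
  · rw [smul_apply, key _ (hu2 _), smul_eq_mul]
    ring
  · exact ((hu2 _).comp ((differentiable_id.sub_const a).const_smul c)) x

lemma fderiv_comp_quadratic {d : ℕ} {F : ℝ → ℝ} (hF : Differentiable ℝ F) (α c : ℝ) (b x : Euc d)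
    (i : Fin d) :
    fderiv ℝ (fun y : Euc d => F (α * ‖y‖ ^ 2 + inner ℝ b y + c)) x (EuclideanSpace.single i 1) =
      deriv F (α * ‖x‖ ^ 2 + inner ℝ b x + c) * (2 * α * x i + b i) := by
  have h1 : HasFDerivAt (fun y : Euc d => α * ‖y‖ ^ 2 + inner ℝ b y + c)
      (α • (2 • innerSL ℝ x) + innerSL ℝ b) x :=
    (((hasStrictFDerivAt_norm_sq x).hasFDerivAt.const_mul α).add
      (innerSL ℝ b).hasFDerivAt).add_const c
  have h2 := (hF (α * ‖x‖ ^ 2 + inner ℝ b x + c)).hasDerivAt.comp_hasFDerivAt x h1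
  have h3 : fderiv ℝ (fun y : Euc d => F (α * ‖y‖ ^ 2 + inner ℝ b y + c)) x = _ := h2.fderiv
  rw [h3]
  simp [EuclideanSpace.inner_single_right]
  ring_nf

lemma lap_comp_quadratic {d : ℕ} {F : ℝ → ℝ} (hF : ContDiff ℝ 2 F) (α c : ℝ) (b x : Euc d) :
    lap (fun y : Euc d => F (α * ‖y‖ ^ 2 + inner ℝ b y + c)) x =
      deriv (deriv F) (α * ‖x‖ ^ 2 + inner ℝ b x + c) * ‖(2 * α) • x + b‖ ^ 2 +
        deriv F (α * ‖x‖ ^ 2 + inner ℝ b x + c) * (2 * α * d) := by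
  have hF1 : ContDiff ℝ 1 (deriv F) := (contDiff_succ_iff_deriv (n := 1).1 hF).2.2
  have hq : ContDiff ℝ 2 (fun y : Euc d => α * ‖y‖ ^ 2 + inner ℝ b y + c) :=
    ((contDiff_const.mul (contDiff_norm_sq ℝ)).add (innerSL ℝ b).contDiff).add contDiff_const
  have hFq : ContDiff ℝ 2 (fun y : Euc d => F (α * ‖y‖ ^ 2 + inner ℝ b y + c)) := hF.comp hq
  rw [lap_eq_sum_fderiv_fderiv hFq.contDiffAt, EuclideanSpace.norm_sq_eq ((2 * α) • x + b),
    Finset.mul_sum]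
  have hd : deriv F (α * ‖x‖ ^ 2 + inner ℝ b x + c) * (2 * α * d) =
      ∑ _i : Fin d, deriv F (α * ‖x‖ ^ 2 + inner ℝ b x + c) * (2 * α) := by
    simp
    ring
  rw [hd, ← Finset.sum_add_distrib]
  refine Finset.sum_congr rfl fun i _ => ?_
  simp only [fderiv_comp_quadratic (hF.differentiable (by norm_num))]
  have hcoord : HasFDerivAt (fun y : Euc d => 2 * α * y i + b i)
      ((2 * α) • (EuclideanSpace.proj i : Euc d →L[ℝ] ℝ)) x :=
    ((EuclideanSpace.proj i : Euc d →L[ℝ] ℝ).hasFDerivAt.const_mul (2 * α)).add_const (b i)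
  have hdF : Differentiable ℝ (fun y : Euc d => deriv F (α * ‖y‖ ^ 2 + inner ℝ b y + c)) :=
    (hF1.differentiable (by norm_num)).comp (hq.differentiable (by norm_num))
  rw [fderiv_fun_mul (hdF x)
    hcoord.differentiableAt, hcoord.fderiv]
  simp [fderiv_comp_quadratic (hF1.differentiable (by norm_num))]
  ring

/-! ### Integration by parts against test functions -/

lemma integrable_mul_of_tsupport_subset {d : ℕ} {U : Set (Euc d)} (hU : IsOpen U)
    {φ g : Euc d → ℝ} (hφ : ContinuousOn φ U) (hg : Continuous g) (hc : HasCompactSupport g)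
    (hs : tsupport g ⊆ U) : Integrable (fun x => φ x * g x) := by
  refine Continuous.integrable_of_hasCompactSupport ?_ hc.mul_left
  exact (hφ.mul hg.continuousOn).continuous_of_tsupport_subset hU
    ((tsupport_mul_subset_right (f := φ) (g := g)).trans hs)

lemma setIntegral_mul_eq_integral {d : ℕ} {U : Set (Euc d)} {φ g : Euc d → ℝ}
    (hs : tsupport g ⊆ U) : ∫ x in U, φ x * g x = ∫ x, φ x * g x := by
  refine setIntegral_eq_integral_of_forall_compl_eq_zero fun x hx => ?_
  rw [image_eq_zero_of_notMem_tsupport fun h => hx (hs h), mul_zero]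

/-- Harmonic functions are orthogonal to Laplacians of test functions. -/
lemma IsHarmonicOn.integral_mul_lap_eq_zero {d : ℕ} {U : Set (Euc d)} (hU : IsOpen U)
    {φ g : Euc d → ℝ} (hφ : IsHarmonicOn φ U) (hg : IsTestFun g) (hs : tsupport g ⊆ U) :
    ∫ x in U, φ x * lap g x = 0 := by
  have hφ2 (x) (hx : x ∈ U) : ContDiffAt ℝ 2 φ x := hφ.1.contDiffAt (hU.mem_nhds hx)
  have hφ1 (x) (hx : x ∈ U) (e : Euc d) : ContDiffAt ℝ 1 (fun y => fderiv ℝ φ y e) x :=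
    ((hφ2 x hx).fderiv_right (m := 1) (by norm_num)).clm_apply contDiffAt_const
  have hφ0 (x) (hx : x ∈ U) (e : Euc d) :
      ContinuousAt (fun y => fderiv ℝ (fun y => fderiv ℝ φ y e) y e) x :=
    (((hφ1 x hx e).fderiv_right (m := 0) (by norm_num)).clm_apply contDiffAt_const).continuousAt
  have hg1 (e : Euc d) : ContDiff ℝ (⊤ : ℕ∞) (fun y => fderiv ℝ g y e) :=
    (hg.1.fderiv_right (m := (⊤ : ℕ∞)) (by simp)).clm_apply contDiff_const
  have hg2 (e : Euc d) : ContDiff ℝ (⊤ : ℕ∞) (fun y => fderiv ℝ (fun y => fderiv ℝ g y e) y e) :=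
    ((hg1 e).fderiv_right (m := (⊤ : ℕ∞)) (by simp)).clm_apply contDiff_const
  have hs1 (e : Euc d) : tsupport (fun y => fderiv ℝ g y e) ⊆ tsupport g :=
    tsupport_fderiv_apply_subset ℝ e
  have hs2 (e : Euc d) : tsupport (fun y => fderiv ℝ (fun y => fderiv ℝ g y e) y e) ⊆ tsupport g :=
    (tsupport_fderiv_apply_subset ℝ e).trans (hs1 e)
  have hc1 (e : Euc d) : HasCompactSupport (fun y => fderiv ℝ g y e) :=
    hg.2.mono' ((subset_tsupport _).trans (hs1 e))
  have hc2 (e : Euc d) : HasCompactSupport (fun y => fderiv ℝ (fun y => fderiv ℝ g y e) y e) :=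
    hg.2.mono' ((subset_tsupport _).trans (hs2 e))
  have hI2 (e : Euc d) :
      Integrable (fun x => φ x * fderiv ℝ (fun y => fderiv ℝ g y e) x e) :=
    integrable_mul_of_tsupport_subset hU hφ.1.continuousOn (hg2 e).continuous (hc2 e)
      ((hs2 e).trans hs)
  have hI1 (e : Euc d) : Integrable (fun x => φ x * fderiv ℝ g x e) :=
    integrable_mul_of_tsupport_subset hU hφ.1.continuousOn (hg1 e).continuous (hc1 e)
      ((hs1 e).trans hs)
  have hJ1 (e : Euc d) : Integrable (fun x => fderiv ℝ φ x e * fderiv ℝ g x e) :=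
    integrable_mul_of_tsupport_subset hU
      (fun x hx => (hφ1 x hx e).continuousAt.continuousWithinAt) (hg1 e).continuous (hc1 e)
      ((hs1 e).trans hs)
  have hJ0 (e : Euc d) : Integrable (fun x => fderiv ℝ φ x e * g x) :=
    integrable_mul_of_tsupport_subset hU
      (fun x hx => (hφ1 x hx e).continuousAt.continuousWithinAt) hg.1.continuous hg.2 hs
  have hK (e : Euc d) : Integrable (fun x => fderiv ℝ (fun y => fderiv ℝ φ y e) x e * g x) :=
    integrable_mul_of_tsupport_subset hU
      (fun x hx => (hφ0 x hx e).continuousWithinAt) hg.1.continuous hg.2 hs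
  have hparts (e : Euc d) : ∫ x, φ x * fderiv ℝ (fun y => fderiv ℝ g y e) x e =
      ∫ x, fderiv ℝ (fun y => fderiv ℝ φ y e) x e * g x := by
    rw [integral_mul_fderiv_eq_neg_fderiv_mul_of_integrable (hJ1 e) (hI2 e) (hI1 e)
        (fun x hx => (hφ2 x (hs (hs1 e hx))).differentiableAt (by norm_num))
        (fun x _ => (hg1 e).differentiable (by simp) x),
      integral_mul_fderiv_eq_neg_fderiv_mul_of_integrable (hK e) (hJ1 e) (hJ0 e)
        (fun x hx => (hφ1 x (hs hx) e).differentiableAt (by norm_num))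
        (fun x _ => hg.1.differentiable (by simp) x), neg_neg]
  rw [setIntegral_mul_eq_integral ((tsupport_lap_subset g).trans hs)]
  simp_rw [lap_eq_sum_fderiv_fderiv (contDiff_infty.1 hg.1 2).contDiffAt, Finset.mul_sum]
  rw [integral_finsetSum _ fun i _ => hI2 _]
  simp_rw [hparts]
  rw [← integral_finsetSum _ fun i _ => hK _]
  refine integral_eq_zero_of_ae (Eventually.of_forall fun x => ?_)
  simp only [Pi.zero_apply, ← Finset.sum_mul]
  by_cases hx : x ∈ U
  · rw [← lap_eq_sum_fderiv_fderiv (hφ2 x hx), hφ.2 x hx]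
    simp
  · rw [image_eq_zero_of_notMem_tsupport fun h => hx (hs h)]
    simp

/-! ### One-dimensional profiles -/

/-- There is a smooth `V` such that `V (‖x‖ ^ 2)` has nonnegative Laplacian, which is nonzero and
vanishes for `δ ≤ ‖x‖ ^ 2`. The left-hand side of the inequalities is that Laplacian in terms of
`t = ‖x‖ ^ 2`. -/
lemma exists_smooth_radial_subharmonic (d : ℕ) {δ : ℝ} (hδ : 0 < δ) :
    ∃ V : ℝ → ℝ, ContDiff ℝ (⊤ : ℕ∞) V ∧
      (∀ t, 0 ≤ t → 0 ≤ 4 * t * deriv (deriv V) t + 2 * d * deriv V t) ∧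
      (∀ t, δ ≤ t → 4 * t * deriv (deriv V) t + 2 * d * deriv V t = 0) ∧
      ∃ t, 0 < t ∧ t < δ ∧ 0 < 4 * t * deriv (deriv V) t + 2 * d * deriv V t := by
  set L : ℝ → ℝ := fun t => Real.smoothTransition (2 * t / δ - 1) with hL
  have hLsmooth : ContDiff ℝ (⊤ : ℕ∞) L :=
    Real.smoothTransition.contDiff.comp (((contDiff_const.mul contDiff_id).div_const δ).sub
      contDiff_const)
  have hLzero (t) (ht : t ≤ δ / 2) : L t = 0 := by
    refine Real.smoothTransition.zero_of_nonpos ?_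
    rw [sub_nonpos, div_le_one hδ]
    linarith
  have hLone (t) (ht : δ ≤ t) : L t = 1 := by
    refine Real.smoothTransition.one_of_one_le ?_
    rw [le_sub_iff_add_le, le_div_iff₀ hδ]
    linarith
  have hLmono : Monotone L := by
    intro s t hst
    refine Real.smoothTransition.monotone ?_
    have := div_le_div_of_nonneg_right (mul_le_mul_of_nonneg_left hst zero_le_two) hδ.le
    linarith
  have hLdiff : Differentiable ℝ L := hLsmooth.differentiable (by simp)
  set p : ℝ := -((d : ℝ) / 2) with hp
  set m : ℝ → ℝ := fun t => L t * t ^ p with hm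
  have hmzero (t) (ht : t < δ / 2) : m =ᶠ[𝓝 t] fun _ => 0 := by
    filter_upwards [Iio_mem_nhds ht] with s hs
    simp only [hm, hLzero s (le_of_lt hs), zero_mul]
  have hmsmooth : ContDiff ℝ (⊤ : ℕ∞) m := by
    refine contDiff_iff_contDiffAt.2 fun t => ?_
    rcases lt_or_ge t (δ / 2) with ht | ht
    · exact contDiffAt_const.congr_of_eventuallyEq (hmzero t ht)
    · exact hLsmooth.contDiffAt.mul (Real.contDiffAt_rpow_const_of_ne (by linarith))
  set V : ℝ → ℝ := fun t => ∫ s in (0 : ℝ)..t, m s with hV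
  have hVderiv (t) : HasDerivAt V (m t) t :=
    intervalIntegral.integral_hasDerivAt_right (hmsmooth.continuous.intervalIntegrable _ _)
      hmsmooth.continuous.aestronglyMeasurable.stronglyMeasurableAtFilter
      hmsmooth.continuous.continuousAt
  have hV' : deriv V = m := funext fun t => (hVderiv t).deriv
  have hVsmooth : ContDiff ℝ (⊤ : ℕ∞) V :=
    contDiff_infty_iff_deriv.2 ⟨fun t => (hVderiv t).differentiableAt, hV' ▸ hmsmooth⟩
  have hW (t) (ht : 0 < t) :
      4 * t * deriv m t + 2 * d * m t = 4 * deriv L t * t ^ (p + 1) := by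
    have h := (hLdiff t).hasDerivAt.mul (Real.hasDerivAt_rpow_const (p := p) (Or.inl ht.ne'))
    have h' : deriv m t = _ := h.deriv
    have h1 : t ^ (p - 1) * t = t ^ p := by
      rw [← Real.rpow_add_one ht.ne', sub_add_cancel]
    rw [h', hm, Real.rpow_add_one ht.ne']
    have hd : (d : ℝ) = -2 * p := by rw [hp]; ring
    rw [hd]
    linear_combination 4 * L t * p * h1
  refine ⟨V, hVsmooth, ?_⟩
  rw [hV']
  refine ⟨fun t ht => ?_, fun t ht => ?_, ?_⟩
  · rcases ht.eq_or_lt with rfl | ht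
    · rw [(hmzero 0 (by positivity)).eq_of_nhds]
      simp
    · rw [hW t ht]
      have := hLmono.deriv_nonneg (x := t)
      positivity
  · have hmax : IsLocalMax L t := Eventually.of_forall fun s => by
      rw [hLone t ht]
      exact Real.smoothTransition.le_one _
    rw [hW t (hδ.trans_le ht), hmax.deriv_eq_zero]
    simp
  · obtain ⟨c, hc, hslope⟩ := exists_deriv_eq_slope L (half_lt_self hδ)
      hLdiff.continuous.continuousOn hLdiff.differentiableOn
    have hc0 : 0 < c := (half_pos hδ).trans hc.1
    refine ⟨c, hc0, hc.2, ?_⟩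
    rw [hW c hc0, hslope, hLone δ le_rfl, hLzero _ le_rfl]
    have : 0 < δ - δ / 2 := by linarith
    positivity

lemma exists_smooth_step : ∃ (κ : ℝ → ℝ) (M : ℝ), ContDiff ℝ (⊤ : ℕ∞) κ ∧ 0 ≤ M ∧
    (∀ s ≤ 1, κ s = 0) ∧ (∀ s, 2 ≤ s → κ s = 1) ∧
    (∀ s ∉ Icc (1 : ℝ) 2, deriv κ s = 0 ∧ deriv (deriv κ) s = 0) ∧
    ∀ s, |deriv κ s| ≤ M ∧ |deriv (deriv κ) s| ≤ M := by
  set κ : ℝ → ℝ := fun s => Real.smoothTransition (s - 1)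
  have hκ : ContDiff ℝ (⊤ : ℕ∞) κ :=
    Real.smoothTransition.contDiff.comp (contDiff_id.sub contDiff_const)
  have hκ1 : ContDiff ℝ (⊤ : ℕ∞) (deriv κ) := (contDiff_infty_iff_deriv.1 hκ).2
  have hκ2 : ContDiff ℝ (⊤ : ℕ∞) (deriv (deriv κ)) := (contDiff_infty_iff_deriv.1 hκ1).2
  have h0 (s) (hs : s ≤ 1) : κ s = 0 := Real.smoothTransition.zero_of_nonpos (by linarith)
  have h1 (s) (hs : 2 ≤ s) : κ s = 1 := Real.smoothTransition.one_of_one_le (by linarith)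
  have hout (s) (hs : s ∉ Icc (1 : ℝ) 2) : deriv κ s = 0 ∧ deriv (deriv κ) s = 0 := by
    have hc : ∃ c : ℝ, κ =ᶠ[𝓝 s] fun _ => c := by
      rcases lt_or_ge s 1 with h | h
      · exact ⟨0, by filter_upwards [Iio_mem_nhds h] with t ht using h0 t (le_of_lt ht)⟩
      · refine ⟨1, ?_⟩
        filter_upwards [Ioi_mem_nhds (not_le.1 fun h2 => hs ⟨h, h2⟩)] with t ht
        exact h1 t (le_of_lt ht)
    obtain ⟨c, hc⟩ := hc
    exact ⟨by simp [hc.deriv_eq], by simp [hc.deriv.deriv_eq]⟩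
  obtain ⟨M₁, hM₁⟩ := isCompact_Icc.exists_bound_of_continuousOn
    (hκ1.continuous.continuousOn (s := Icc 1 2))
  obtain ⟨M₂, hM₂⟩ := isCompact_Icc.exists_bound_of_continuousOn
    (hκ2.continuous.continuousOn (s := Icc 1 2))
  refine ⟨κ, max 0 (max M₁ M₂), hκ, le_max_left _ _, h0, h1, hout, fun s => ?_⟩
  by_cases hs : s ∈ Icc (1 : ℝ) 2
  · exact ⟨(hM₁ s hs).trans (by simp), (hM₂ s hs).trans (by simp)⟩
  · simp [hout s hs]

/-! ### A smoothed Green function of the unit ball -/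

lemma exists_smoothed_green {d : ℕ} (hd : 2 ≤ d) {z : Euc d} (hz : ‖z‖ < 1) {ε : ℝ} (hε : 0 < ε) :
    ∃ (u f : Euc d → ℝ) (C ρ : ℝ), ContDiff ℝ (⊤ : ℕ∞) u ∧ IsTestFun f ∧ 0 ≤ C ∧ 0 ≤ ρ ∧ ρ < 1 ∧
      tsupport f ⊆ closedBall z ε ∧ tsupport f ⊆ closedBall 0 ρ ∧ (∀ x, 0 ≤ f x) ∧
      (∃ x, f x ≠ 0) ∧ (∀ x, ‖x‖ ≤ 1 → lap u x = f x) ∧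
      ∀ x, ‖x‖ ≤ 1 → |u x| ≤ C * (1 - ‖x‖ ^ 2) := by
  set η : ℝ := min ε ((1 - ‖z‖) / 2) with hη
  have hη0 : 0 < η := lt_min hε (by linarith)
  have hη1 : η ≤ (1 - ‖z‖) / 2 := min_le_right _ _
  obtain ⟨V, hV, hWnn, hWzero, t₀, ht₀, ht₀η, hWpos⟩ :=
    exists_smooth_radial_subharmonic d (pow_pos hη0 2)
  have hV1 : ContDiff ℝ (⊤ : ℕ∞) (deriv V) := (contDiff_infty_iff_deriv.1 hV).2
  have hV2 : ContDiff ℝ (⊤ : ℕ∞) (deriv (deriv V)) := (contDiff_infty_iff_deriv.1 hV1).2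
  set W : ℝ → ℝ := fun t => 4 * t * deriv (deriv V) t + 2 * d * deriv V t with hW
  have hWsmooth : ContDiff ℝ (⊤ : ℕ∞) W :=
    ((contDiff_const.mul contDiff_id).mul hV2).add (contDiff_const.mul hV1)
  set P : Euc d → ℝ := fun x => 1 * ‖x‖ ^ 2 + inner ℝ ((-2 : ℝ) • z) x + ‖z‖ ^ 2 with hP
  set Q : Euc d → ℝ := fun x => ‖z‖ ^ 2 * ‖x‖ ^ 2 + inner ℝ ((-2 : ℝ) • z) x + 1 with hQ
  have hquad (α c : ℝ) : ContDiff ℝ (⊤ : ℕ∞)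
      (fun x : Euc d => α * ‖x‖ ^ 2 + inner ℝ ((-2 : ℝ) • z) x + c) :=
    ((contDiff_const.mul (contDiff_norm_sq ℝ)).add
      (innerSL ℝ ((-2 : ℝ) • z)).contDiff).add contDiff_const
  have hPeq (x : Euc d) : P x = ‖x - z‖ ^ 2 := by
    rw [norm_sub_sq_real, real_inner_comm]
    simp only [hP, inner_smul_left]
    simp
    ring
  have hQP (x : Euc d) : Q x = P x + (1 - ‖x‖ ^ 2) * (1 - ‖z‖ ^ 2) := by
    simp only [hP, hQ]
    ring
  have hQge (x : Euc d) (hx : ‖x‖ ≤ 1) : η ^ 2 ≤ Q x := by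
    have h1 : inner ℝ z x ≤ ‖z‖ * ‖x‖ := real_inner_le_norm z x
    have h2 : Q x = ‖z‖ ^ 2 * ‖x‖ ^ 2 - 2 * inner ℝ z x + 1 := by
      simp only [hQ, inner_smul_left]
      simp
      ring
    have h3 : η ≤ 1 - ‖z‖ * ‖x‖ := by nlinarith [norm_nonneg z, norm_nonneg x]
    nlinarith
  have hlap (α c : ℝ) (x : Euc d) :
      lap (fun y => V (α * ‖y‖ ^ 2 + inner ℝ ((-2 : ℝ) • z) y + c)) x =
        deriv (deriv V) (α * ‖x‖ ^ 2 + inner ℝ ((-2 : ℝ) • z) x + c) *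
          ‖(2 * α) • x + (-2 : ℝ) • z‖ ^ 2 +
        deriv V (α * ‖x‖ ^ 2 + inner ℝ ((-2 : ℝ) • z) x + c) * (2 * α * d) :=
    lap_comp_quadratic (contDiff_infty.1 hV 2) α c _ x
  have hgrad (α c : ℝ) (x : Euc d) : ‖(2 * α) • x + (-2 : ℝ) • z‖ ^ 2 =
      4 * α * (α * ‖x‖ ^ 2 + inner ℝ ((-2 : ℝ) • z) x + c) + 4 * (‖z‖ ^ 2 - α * c) := by
    rw [norm_add_sq_real, norm_smul, norm_smul, inner_smul_left, inner_smul_right,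
      inner_smul_left, real_inner_comm x z, mul_pow, mul_pow, Real.norm_eq_abs, sq_abs]
    simp
    ring
  have hlapP (x : Euc d) : lap (fun y => V (P y)) x = W (P x) := by
    rw [hlap 1 (‖z‖ ^ 2) x, hgrad 1 (‖z‖ ^ 2) x]
    simp only [hW, hP]
    ring
  have hlapQ (x : Euc d) : lap (fun y => V (Q y)) x = ‖z‖ ^ 2 * W (Q x) := by
    rw [hlap (‖z‖ ^ 2) 1 x, hgrad (‖z‖ ^ 2) 1 x]
    simp only [hW, hQ]
    ring
  have hsupp : tsupport (fun x => W (P x)) ⊆ closedBall z η := by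
    refine closure_minimal (fun x hx => ?_) isClosed_closedBall
    rw [mem_closedBall_iff_norm]
    by_contra! h
    refine hx (hWzero _ ?_)
    rw [hPeq]
    exact pow_le_pow_left₀ hη0.le h.le 2
  have hPsmooth : ContDiff ℝ (⊤ : ℕ∞) (fun x => V (P x)) := hV.comp (hquad 1 (‖z‖ ^ 2))
  have hQsmooth : ContDiff ℝ (⊤ : ℕ∞) (fun x => V (Q x)) := hV.comp (hquad (‖z‖ ^ 2) 1)
  obtain ⟨M, hM⟩ := (isCompact_Icc (a := (0 : ℝ)) (b := 5)).exists_bound_of_continuousOn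
    hV1.continuous.continuousOn
  have hM0 : 0 ≤ M := (norm_nonneg _).trans (hM 0 (by norm_num))
  refine ⟨fun x => V (P x) - V (Q x), fun x => W (P x), M, (1 + ‖z‖) / 2, hPsmooth.sub hQsmooth,
    ⟨hWsmooth.comp (hquad 1 (‖z‖ ^ 2)), ?_⟩, hM0, by positivity, by linarith,
    hsupp.trans (closedBall_subset_closedBall (min_le_left _ _)),
    hsupp.trans (closedBall_subset_closedBall' ?_), fun x => hWnn _ ?_, ?_, fun x hx => ?_,
    fun x hx => ?_⟩
  · exact HasCompactSupport.of_support_subset_isCompact (isCompact_closedBall z η)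
      ((subset_tsupport _).trans hsupp)
  · rw [dist_zero_right]
    linarith
  · rw [hPeq]
    positivity
  · refine ⟨z + √t₀ • EuclideanSpace.single (⟨0, by omega⟩ : Fin d) (1 : ℝ), ?_⟩
    simp only [hPeq, add_sub_cancel_left, norm_smul, PiLp.norm_single, norm_one, mul_one,
      Real.norm_eq_abs, sq_abs, Real.sq_sqrt ht₀.le]
    exact hWpos.ne'
  · rw [lap_sub (contDiff_infty.1 hPsmooth 2).contDiffAt (contDiff_infty.1 hQsmooth 2).contDiffAt,
      hlapP, hlapQ]
    have : W (Q x) = 0 := hWzero _ (hQge x hx)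
    rw [this]
    ring
  · have hx2 : ‖x‖ ^ 2 ≤ 1 := pow_le_one₀ (norm_nonneg x) hx
    have hz2 : ‖z‖ ^ 2 ≤ 1 := pow_le_one₀ (norm_nonneg z) hz.le
    have hP0 : 0 ≤ P x := by rw [hPeq]; positivity
    have hP4 : P x ≤ 4 := by
      rw [hPeq]
      have : ‖x - z‖ ≤ 2 := (norm_sub_le x z).trans (by linarith)
      nlinarith [norm_nonneg (x - z)]
    have hQPle : Q x - P x ≤ 1 - ‖x‖ ^ 2 := by
      rw [hQP]
      nlinarith [sq_nonneg ‖z‖]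
    have hQP0 : 0 ≤ Q x - P x := by
      rw [hQP, add_sub_cancel_left]
      exact mul_nonneg (by linarith) (by linarith)
    have h := (convex_Icc (0 : ℝ) 5).norm_image_sub_le_of_norm_deriv_le
      (fun t _ => hV.differentiable (by simp) t) hM
      (⟨by linarith, by nlinarith⟩ : Q x ∈ Icc (0 : ℝ) 5) (⟨hP0, by linarith⟩ : P x ∈ Icc (0 : ℝ) 5)
    rw [norm_sub_rev (P x), Real.norm_eq_abs, Real.norm_eq_abs, abs_of_nonneg hQP0] at h
    exact h.trans (mul_le_mul_of_nonneg_left hQPle hM0)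

/-! ### Truncation near the sphere -/

lemma exists_lap_sub_bounded_on_shell {d : ℕ} {u f : Euc d → ℝ} {C ρ : ℝ}
    (hu : ContDiff ℝ (⊤ : ℕ∞) u) (hC : 0 ≤ C) (hρ1 : ρ < 1)
    (hf : tsupport f ⊆ closedBall 0 ρ) (hlap : ∀ x, ‖x‖ ≤ 1 → lap u x = f x)
    (hbd : ∀ x, ‖x‖ ≤ 1 → |u x| ≤ C * (1 - ‖x‖ ^ 2)) :
    ∃ K : ℝ, 0 < K ∧ ∀ N : ℝ, 1 ≤ N → 2 ≤ N * (1 - ρ ^ 2) → ∃ g : Euc d → ℝ, IsTestFun g ∧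
      tsupport g ⊆ ball 0 1 ∧ ∀ x, |lap g x - f x| ≤ K * N ∧
        (N * (1 - ‖x‖ ^ 2) ∉ Icc (1 : ℝ) 2 → lap g x - f x = 0) := by
  obtain ⟨κ, M, hκ, hM0, hκ0, hκ1, hκout, hκM⟩ := exists_smooth_step
  obtain ⟨G, hG⟩ := (isCompact_closedBall (0 : Euc d) 1).exists_bound_of_continuousOn
    (hu.continuous_fderiv (by simp)).continuousOn
  have hG0 : 0 ≤ G := (norm_nonneg _).trans (hG 0 (by simp))
  refine ⟨8 * C * M + 4 * C * d * M + 4 * d * M * G + 1, by positivity, fun N hN hNρ => ?_⟩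
  have hN0 : 0 < N := by linarith
  set p : Euc d → ℝ := fun x => -N * ‖x‖ ^ 2 + inner ℝ (0 : Euc d) x + N with hp
  have hpeq (x : Euc d) : p x = N * (1 - ‖x‖ ^ 2) := by
    simp only [hp, inner_zero_left]
    ring
  have hpsmooth : ContDiff ℝ (⊤ : ℕ∞) p :=
    ((contDiff_const.mul (contDiff_norm_sq ℝ)).add
      (innerSL ℝ (0 : Euc d)).contDiff).add contDiff_const
  have hκp : ContDiff ℝ (⊤ : ℕ∞) (fun x => κ (p x)) := hκ.comp hpsmooth
  have hsupp : tsupport (fun x => κ (p x) * u x) ⊆ {x | 1 ≤ p x} := by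
    refine closure_minimal (fun x hx => ?_) (isClosed_le continuous_const hpsmooth.continuous)
    by_contra h
    exact hx (by simp only [hκ0 _ (not_le.1 h).le, zero_mul])
  have hball : {x | 1 ≤ p x} ⊆ ball (0 : Euc d) 1 := by
    intro x hx
    rw [mem_ofPred_eq, hpeq] at hx
    rw [mem_ball_zero_iff]
    by_contra! h
    have : 1 ≤ ‖x‖ ^ 2 := one_le_pow₀ h
    nlinarith
  have hlapg (x : Euc d) : lap (fun y => κ (p y) * u y) x = κ (p x) * lap u x +
      u x * (deriv (deriv κ) (p x) * (4 * N ^ 2 * ‖x‖ ^ 2) - deriv κ (p x) * (2 * N * d)) -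
      4 * N * (deriv κ (p x) * ∑ i, x i * fderiv ℝ u x (EuclideanSpace.single i 1)) := by
    rw [lap_mul (contDiff_infty.1 hκp 2) (contDiff_infty.1 hu 2),
      lap_comp_quadratic (contDiff_infty.1 hκ 2) (-N) N 0 x]
    simp only [p, fderiv_comp_quadratic (hκ.differentiable (by simp))]
    rw [add_zero, norm_smul, mul_pow, Real.norm_eq_abs, sq_abs, Finset.mul_sum, Finset.mul_sum,
      Finset.mul_sum]
    rw [sub_eq_add_neg _ (Finset.sum _ _), ← Finset.sum_neg_distrib]
    congr 1
    · ring
    · refine Finset.sum_congr rfl fun i _ => ?_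
      simp
      ring
  have hfzero (x : Euc d) (hx : ρ < ‖x‖) : f x = 0 :=
    image_eq_zero_of_notMem_tsupport fun h => by
      have := hf h
      rw [mem_closedBall_zero_iff] at this
      linarith
  have hκf (x : Euc d) : κ (p x) * f x = f x := by
    rcases lt_or_ge ρ ‖x‖ with hx | hx
    · rw [hfzero x hx, mul_zero]
    · rw [hκ1 (p x), one_mul]
      rw [hpeq]
      have : ‖x‖ ^ 2 ≤ ρ ^ 2 := pow_le_pow_left₀ (norm_nonneg x) hx 2
      nlinarith
  have hdiff (x : Euc d) : lap (fun y => κ (p y) * u y) x - f x =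
      u x * (deriv (deriv κ) (p x) * (4 * N ^ 2 * ‖x‖ ^ 2) - deriv κ (p x) * (2 * N * d)) -
      4 * N * (deriv κ (p x) * ∑ i, x i * fderiv ℝ u x (EuclideanSpace.single i 1)) := by
    have h1 : κ (p x) * lap u x = f x := by
      rcases le_or_gt ‖x‖ 1 with hx | hx
      · rw [hlap x hx, hκf]
      · rw [hκ0, zero_mul, hfzero x (hρ1.trans hx)]
        rw [hpeq]
        have : 1 ≤ ‖x‖ ^ 2 := one_le_pow₀ hx.le
        nlinarith
    rw [hlapg, h1]
    ring
  have hzero (x : Euc d) (hx : p x ∉ Icc (1 : ℝ) 2) :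
      lap (fun y => κ (p y) * u y) x - f x = 0 := by
    rw [hdiff, (hκout _ hx).1, (hκout _ hx).2]
    ring
  refine ⟨fun x => κ (p x) * u x, ⟨hκp.mul hu, ?_⟩, hsupp.trans hball, fun x => ⟨?_, ?_⟩⟩
  · refine HasCompactSupport.of_support_subset_isCompact (isCompact_closedBall (0 : Euc d) 1) ?_
    exact (subset_tsupport _).trans ((hsupp.trans hball).trans ball_subset_closedBall)
  · by_cases hx : p x ∈ Icc (1 : ℝ) 2
    · have hx1 : ‖x‖ ≤ 1 := (mem_ball_zero_iff.1 (hball hx.1)).le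
      have hx2 : ‖x‖ ^ 2 ≤ 1 := pow_le_one₀ (norm_nonneg x) hx1
      have hNu : N * |u x| ≤ 2 * C := by
        have h2 := hx.2
        rw [hpeq] at h2
        calc N * |u x| ≤ N * (C * (1 - ‖x‖ ^ 2)) := by gcongr; exact hbd x hx1
          _ = C * (N * (1 - ‖x‖ ^ 2)) := by ring
          _ ≤ C * 2 := by gcongr
          _ = 2 * C := by ring
      have hsum : |∑ i, x i * fderiv ℝ u x (EuclideanSpace.single i 1)| ≤ d * G := by
        refine (Finset.abs_sum_le_sum_abs _ _).trans ?_
        calc _ ≤ ∑ _i : Fin d, G := by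
              refine Finset.sum_le_sum fun i _ => ?_
              rw [abs_mul]
              have h1 : |x i| ≤ 1 := (PiLp.norm_apply_le x i).trans hx1
              have h2 : |fderiv ℝ u x (EuclideanSpace.single i 1)| ≤ G := by
                have := (fderiv ℝ u x).le_opNorm (EuclideanSpace.single i 1)
                rw [PiLp.norm_single, norm_one, mul_one] at this
                exact this.trans (hG x (by simpa using hx1))
              calc _ ≤ 1 * G := by gcongr
                _ = G := one_mul G
          _ = d * G := by simp
      rw [hdiff]
      have hA : |u x * (deriv (deriv κ) (p x) * (4 * N ^ 2 * ‖x‖ ^ 2) -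
          deriv κ (p x) * (2 * N * d))| ≤ 8 * C * M * N + 4 * C * d * M * N := by
        have hb : |deriv (deriv κ) (p x) * (4 * N ^ 2 * ‖x‖ ^ 2) - deriv κ (p x) * (2 * N * d)| ≤
            M * (4 * N ^ 2 * 1) + M * (2 * N * d) := by
          refine (abs_sub _ _).trans ?_
          rw [abs_mul (deriv (deriv κ) (p x)), abs_mul (deriv κ (p x)),
            abs_of_nonneg (by positivity : 0 ≤ 4 * N ^ 2 * ‖x‖ ^ 2),
            abs_of_nonneg (by positivity : 0 ≤ 2 * N * (d : ℝ))]
          gcongr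
          · exact (hκM _).2
          · exact (hκM _).1
        calc _ = |u x| * _ := abs_mul _ _
          _ ≤ |u x| * (M * (4 * N ^ 2 * 1) + M * (2 * N * d)) := by gcongr
          _ = N * |u x| * (4 * M * N + 2 * M * d) := by ring
          _ ≤ 2 * C * (4 * M * N + 2 * M * d) := by gcongr
          _ ≤ 2 * C * (4 * M * N + 2 * M * d * N) := by
            have h1 : 2 * M * d ≤ 2 * M * d * N := le_mul_of_one_le_right (by positivity) hN
            gcongr
          _ = _ := by ring
      have hB : |4 * N * (deriv κ (p x) *
          ∑ i, x i * fderiv ℝ u x (EuclideanSpace.single i 1))| ≤ 4 * d * M * G * N := by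
        rw [abs_mul (4 * N), abs_mul (deriv κ (p x)), abs_of_nonneg (by positivity : 0 ≤ 4 * N)]
        calc _ ≤ 4 * N * (M * (d * G)) := by
              gcongr
              exact (hκM _).1
          _ = _ := by ring
      refine (abs_sub _ _).trans ((add_le_add hA hB).trans ?_)
      nlinarith
    · rw [hzero x hx, abs_zero]
      positivity
  · rw [← hpeq]
    exact hzero x

lemma volume_real_shell_le {d : ℕ} (hd : d ≠ 0) {t : ℝ} (ht0 : 0 ≤ t) (ht1 : t ≤ 1) :
    volume.real (closedBall (0 : Euc d) 1 \ ball 0 (1 - t)) ≤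
      volume.real (ball (0 : Euc d) 1) * (d * t) := by
  have : Nonempty (Fin d) := ⟨⟨0, Nat.pos_of_ne_zero hd⟩⟩
  rw [measureReal_sdiff (ball_subset_closedBall.trans (closedBall_subset_closedBall (by linarith)))
    measurableSet_ball measure_closedBall_lt_top.ne,
    Measure.addHaar_real_closedBall _ _ zero_le_one,
    measureReal_def volume (ball 0 (1 - t)), Measure.addHaar_ball _ _ (by linarith : 0 ≤ 1 - t),
    ENNReal.toReal_mul, ENNReal.toReal_ofReal (pow_nonneg (by linarith) _), ← measureReal_def,
    finrank_euclideanSpace_fin, one_pow, one_mul]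
  have h := one_add_mul_le_pow (by linarith : (-2 : ℝ) ≤ -t) d
  rw [← sub_eq_add_neg] at h
  nlinarith [measureReal_nonneg (μ := volume) (s := ball (0 : Euc d) 1)]

/-! ### Test functions concentrated on shells -/

lemma exists_smooth_bump_Icc : ∃ β : ℝ → ℝ, ContDiff ℝ (⊤ : ℕ∞) β ∧ (∀ s, 0 ≤ β s) ∧
    (∀ s, β s ≤ 1) ∧ (∀ s ∈ Icc (1 : ℝ) 2, β s = 1) ∧
    ∀ s ∉ Icc (1 / 2 : ℝ) (5 / 2), β s = 0 := by
  let b : ContDiffBump (3 / 2 : ℝ) := ⟨1 / 2, 1, by norm_num, by norm_num⟩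
  refine ⟨b, b.contDiff, fun s => b.nonneg, fun s => b.le_one, fun s hs => ?_, fun s hs => ?_⟩
  · refine b.one_of_mem_closedBall ?_
    rw [mem_closedBall, Real.dist_eq, abs_le]
    change -(1 / 2) ≤ s - 3 / 2 ∧ s - 3 / 2 ≤ 1 / 2
    constructor <;> linarith [hs.1, hs.2]
  · refine b.zero_of_le_dist ?_
    rw [Real.dist_eq]
    change 1 ≤ |s - 3 / 2|
    by_contra! h
    rw [abs_lt] at h
    exact hs ⟨by linarith [h.1], by linarith [h.2]⟩

lemma tsupport_subset_of_shell {d : ℕ} {F : Euc d → ℝ} {N : ℝ} (hN : 0 < N)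
    (hF : ∀ x, N * (1 - ‖x‖ ^ 2) ∉ Icc (1 / 2 : ℝ) (5 / 2) → F x = 0) :
    tsupport F ⊆ ball 0 1 \ ball 0 (1 - 5 / 2 / N) := by
  have h1 : tsupport F ⊆ {x | N * (1 - ‖x‖ ^ 2) ∈ Icc (1 / 2 : ℝ) (5 / 2)} := by
    refine closure_minimal (fun x hx => ?_) (isClosed_Icc.preimage (by fun_prop))
    by_contra h
    exact hx (hF x h)
  refine h1.trans fun x hx => ?_
  obtain ⟨h2, h3⟩ := hx
  have hx1 : ‖x‖ < 1 := by
    by_contra! h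
    have : 1 ≤ ‖x‖ ^ 2 := one_le_pow₀ h
    nlinarith
  refine ⟨mem_ball_zero_iff.2 hx1, fun h => ?_⟩
  rw [mem_ball_zero_iff] at h
  have h4 : ‖x‖ ^ 2 ≤ ‖x‖ := by nlinarith [norm_nonneg x]
  have h5 : 5 / 2 / N < 1 - ‖x‖ ^ 2 := by linarith
  rw [div_lt_iff₀ hN] at h5
  linarith

lemma GFF.tendsto_variance_of_shell {d : ℕ} {Ω : Type} [MeasurableSpace Ω] (X : GFF d Ω)
    (hd : d ≠ 0) {β : ℝ → ℝ} (hβ0 : ∀ s, 0 ≤ β s) (hβ1 : ∀ s, β s ≤ 1)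
    (hβI : ∀ s ∈ Icc (1 : ℝ) 2, β s = 1) (hβout : ∀ s ∉ Icc (1 / 2 : ℝ) (5 / 2), β s = 0)
    {K : ℝ} (hK : 0 < K) {N : ℕ → ℝ} (hN : ∀ n, 5 ≤ N n) (hNt : Tendsto N atTop atTop)
    {F : ℕ → Euc d → ℝ} (hF : ∀ n, IsTestFun (F n))
    (hlow : ∀ n x, K * N n * β (N n * (1 - ‖x‖ ^ 2)) ≤ F n x)
    (hup : ∀ n x, F n x ≤ 3 * (K * N n * β (N n * (1 - ‖x‖ ^ 2)))) :
    Tendsto (fun n => ∫ ω, (X.h 0 1 (F n) ω) ^ 2 ∂X.P) atTop (𝓝 0) := by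
  have hNpos (n) : 0 < N n := by linarith [hN n]
  have hsupp (n) : tsupport (F n) ⊆ ball 0 1 \ ball 0 (1 - 5 / 2 / N n) := by
    refine tsupport_subset_of_shell (hNpos n) fun x hx => ?_
    have h1 := hlow n x
    have h2 := hup n x
    rw [hβout _ hx, mul_zero] at h1 h2
    linarith
  have hF0 (n x) : 0 ≤ F n x := by
    have := hNpos n
    have := hβ0 (N n * (1 - ‖x‖ ^ 2))
    exact le_trans (by positivity) (hlow n x)
  refine X.zero_bdry F hF hF0 ?_ ?_ ⟨3, fun n x y hxy _ => ?_⟩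
  · refine ⟨3 * K * (volume.real (ball (0 : Euc d) 1) * (d * (5 / 2))), fun n => ?_⟩
    have hNn := hNpos n
    set S : Set (Euc d) := closedBall 0 1 \ ball 0 (1 - 5 / 2 / N n)
    have hSm : MeasurableSet S := measurableSet_closedBall.diff measurableSet_ball
    have hSf : volume S ≠ ⊤ :=
      ((measure_mono sdiff_subset).trans_lt measure_closedBall_lt_top).ne
    have hFS : ∀ x, x ∉ S → F n x = 0 := fun x hx =>
      image_eq_zero_of_notMem_tsupport fun h =>
        hx ⟨ball_subset_closedBall (hsupp n h).1, (hsupp n h).2⟩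
    have ht1 : 5 / 2 / N n ≤ 1 := by
      rw [div_le_one hNn]
      linarith [hN n]
    calc ∫ x, F n x = ∫ x in S, F n x :=
          (setIntegral_eq_integral_of_forall_compl_eq_zero hFS).symm
      _ ≤ ∫ _x in S, 3 * (K * N n) := by
          refine setIntegral_mono_on
            ((hF n).1.continuous.integrable_of_hasCompactSupport (hF n).2).integrableOn
            (integrableOn_const hSf) hSm fun x _ => (hup n x).trans ?_
          have := mul_le_mul_of_nonneg_left (hβ1 (N n * (1 - ‖x‖ ^ 2))) (mul_pos hK hNn).le
          linarith
      _ = volume.real S * (3 * (K * N n)) := by rw [setIntegral_const, smul_eq_mul]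
      _ ≤ (volume.real (ball (0 : Euc d) 1) * (d * (5 / 2 / N n))) * (3 * (K * N n)) := by
          gcongr
          exact volume_real_shell_le hd (by positivity) ht1
      _ = _ := by
          field_simp
  · have hlim : Tendsto (fun n => 1 - 5 / 2 / N n) atTop (𝓝 1) := by
      simpa using tendsto_const_nhds.sub (hNt.const_div_atTop (5 / 2 : ℝ))
    have hne (n) : (tsupport (F n)).Nonempty := by
      have hNn := hNpos n
      have hN5 := hN n
      have hq : 0 ≤ 1 - 3 / 2 / N n := by
        rw [sub_nonneg, div_le_one hNn]
        linarith
      refine ⟨EuclideanSpace.single ⟨0, Nat.pos_of_ne_zero hd⟩ (√(1 - 3 / 2 / N n)),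
        subset_tsupport _ (ne_of_gt (lt_of_lt_of_le ?_ (hlow n _)))⟩
      rw [PiLp.norm_single, Real.norm_eq_abs, sq_abs, Real.sq_sqrt hq, hβI]
      · positivity
      · have : N n * (1 - (1 - 3 / 2 / N n)) = 3 / 2 := by
          field_simp
          ring
        rw [this]
        norm_num
    refine tendsto_of_tendsto_of_tendsto_of_le_of_le hlim tendsto_const_nhds (fun n => ?_)
      fun n => ?_
    · refine (le_infDist (hne n)).2 fun y hy => ?_
      have := (hsupp n hy).2
      rw [mem_ball_zero_iff, not_lt] at this
      rwa [dist_zero_left]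
    · obtain ⟨y, hy⟩ := hne n
      refine (infDist_le_dist_of_mem hy).trans ?_
      rw [dist_zero_left]
      exact (mem_ball_zero_iff.1 (hsupp n hy).1).le
  · have h1 := hup n x
    rw [hxy] at h1
    linarith [hlow n y]

/-- A test function concentrated near a given point of the ball is, modulo Laplacians of test
functions, a difference of test functions to which the zero boundary condition applies. -/
lemma GFF.exists_balayage {d : ℕ} {Ω : Type} [MeasurableSpace Ω] (X : GFF d Ω) (hd : 2 ≤ d)
    {z : Euc d} (hz : ‖z‖ < 1) {ε : ℝ} (hε : 0 < ε) :
    ∃ (f : Euc d → ℝ) (F B g : ℕ → Euc d → ℝ), IsTestFun f ∧ tsupport f ⊆ closedBall z ε ∧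
      tsupport f ⊆ ball 0 1 ∧ (∀ x, 0 ≤ f x) ∧ (∃ x, f x ≠ 0) ∧
      (∀ n, IsTestFun (F n) ∧ tsupport (F n) ⊆ ball 0 1) ∧
      (∀ n, IsTestFun (B n) ∧ tsupport (B n) ⊆ ball 0 1) ∧
      (∀ n, IsTestFun (g n) ∧ tsupport (g n) ⊆ ball 0 1) ∧
      (∀ n x, f x = lap (g n) x + B n x - F n x) ∧
      Tendsto (fun n => ∫ ω, (X.h 0 1 (F n) ω) ^ 2 ∂X.P) atTop (𝓝 0) ∧
      Tendsto (fun n => ∫ ω, (X.h 0 1 (B n) ω) ^ 2 ∂X.P) atTop (𝓝 0) := by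
  obtain ⟨u, f, C, ρ, hu, hf, hC, hρ0, hρ1, hfz, hfρ, hf0, hfne, hlap, hbd⟩ :=
    exists_smoothed_green hd hz hε
  obtain ⟨K, hK, hg⟩ := exists_lap_sub_bounded_on_shell hu hC hρ1 hfρ hlap hbd
  obtain ⟨β, hβ, hβ0, hβ1, hβI, hβout⟩ := exists_smooth_bump_Icc
  have hρ2 : 0 < 1 - ρ ^ 2 := by nlinarith
  set N : ℕ → ℝ := fun n => n + (5 + 2 / (1 - ρ ^ 2))
  have hN5 (n) : 5 ≤ N n := by
    have : 0 ≤ 2 / (1 - ρ ^ 2) := by positivity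
    simp only [N]
    linarith [Nat.cast_nonneg (α := ℝ) n]
  have hNpos (n) : 0 < N n := by linarith [hN5 n]
  have hNρ (n) : 2 ≤ N n * (1 - ρ ^ 2) := by
    rw [← div_le_iff₀ hρ2]
    simp only [N]
    linarith [Nat.cast_nonneg (α := ℝ) n]
  have hNt : Tendsto N atTop atTop :=
    tendsto_atTop_add_const_right _ _ tendsto_natCast_atTop_atTop
  choose g hgt hgs hgb using fun n => hg (N n) (by linarith [hN5 n]) (hNρ n)
  set b : ℕ → Euc d → ℝ := fun n x => K * N n * β (N n * (1 - ‖x‖ ^ 2))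
  have hbs (n) : ContDiff ℝ (⊤ : ℕ∞) (b n) := by
    have h := contDiff_norm_sq ℝ (E := Euc d) (n := (⊤ : ℕ∞))
    exact contDiff_const.mul (hβ.comp (contDiff_const.mul (contDiff_const.sub h)))
  have hb0 (n x) : 0 ≤ b n x := mul_nonneg (mul_pos hK (hNpos n)).le (hβ0 _)
  have herr (n x) : |lap (g n) x - f x| ≤ b n x := by
    by_cases hx : N n * (1 - ‖x‖ ^ 2) ∈ Icc (1 : ℝ) 2
    · simp only [b]
      rw [hβI _ hx, mul_one]
      exact (hgb n x).1
    · rw [(hgb n x).2 hx, abs_zero]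
      exact hb0 n x
  have hshell {G : Euc d → ℝ} (n) (hG : ContDiff ℝ (⊤ : ℕ∞) G) (h0 : ∀ x, b n x ≤ G x)
      (h1 : ∀ x, G x ≤ 3 * b n x) : IsTestFun G ∧ tsupport G ⊆ ball 0 1 := by
    have hs : tsupport G ⊆ ball 0 1 := by
      refine (tsupport_subset_of_shell (hNpos n) fun x hx => ?_).trans sdiff_subset
      have h2 := h0 x
      have h3 := h1 x
      simp only [b, hβout _ hx, mul_zero] at h2 h3
      linarith
    exact ⟨⟨hG, HasCompactSupport.of_support_subset_isCompact (isCompact_closedBall (0 : Euc d) 1)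
      ((subset_tsupport _).trans (hs.trans ball_subset_closedBall))⟩, hs⟩
  have hF0 (n x) : b n x ≤ 2 * b n x + (lap (g n) x - f x) := by
    linarith [(abs_le.1 (herr n x)).1]
  have hF1 (n x) : 2 * b n x + (lap (g n) x - f x) ≤ 3 * b n x := by
    linarith [(abs_le.1 (herr n x)).2]
  have hB0 (n x) : b n x ≤ 2 * b n x := by linarith [hb0 n x]
  have hB1 (n x) : 2 * b n x ≤ 3 * b n x := by linarith [hb0 n x]
  have hF (n) :=
    hshell n ((contDiff_const.mul (hbs n)).add ((hgt n).lap.1.sub hf.1)) (hF0 n) (hF1 n)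
  have hB (n) := hshell n (contDiff_const.mul (hbs n)) (hB0 n) (hB1 n)
  refine ⟨f, fun n x => 2 * b n x + (lap (g n) x - f x), fun n x => 2 * b n x, g, hf, hfz,
    hfρ.trans (closedBall_subset_ball hρ1), hf0, hfne, hF, hB, fun n => ⟨hgt n, hgs n⟩,
    fun n x => by ring, ?_, ?_⟩
  · exact X.tendsto_variance_of_shell (by lia) hβ0 hβ1 hβI hβout hK hN5 hNt
      (fun n => (hF n).1) hF0 hF1
  · exact X.tendsto_variance_of_shell (by lia) hβ0 hβ1 hβI hβout hK hN5 hNt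
      (fun n => (hB n).1) hB0 hB1

/-! ### Transport to a general ball -/

/-- The test function on `a + r𝔹` corresponding to a test function on `𝔹`. -/
def rescale {d : ℕ} (a : Euc d) (r : ℝ) (f : Euc d → ℝ) : Euc d → ℝ := fun x => f (r⁻¹ • (x - a))

lemma tsupport_rescale_subset {d : ℕ} (a : Euc d) (r : ℝ) (f : Euc d → ℝ) :
    tsupport (rescale a r f) ⊆ (fun x => r⁻¹ • (x - a)) ⁻¹' tsupport f :=
  closure_minimal (fun _ hx => subset_tsupport f hx)
    ((isClosed_tsupport f).preimage (by fun_prop))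

lemma tsupport_rescale_subset_ball {d : ℕ} (a : Euc d) {r : ℝ} (hr : 0 < r) {f : Euc d → ℝ}
    (hf : tsupport f ⊆ ball 0 1) : tsupport (rescale a r f) ⊆ ball a r := fun x hx => by
  have h := hf (tsupport_rescale_subset a r f hx)
  rw [mem_ball_zero_iff, norm_smul, Real.norm_eq_abs, abs_of_pos (inv_pos.2 hr),
    inv_mul_lt_iff₀ hr, mul_one] at h
  rwa [mem_ball_iff_norm]

lemma IsTestFun.rescale {d : ℕ} {f : Euc d → ℝ} (hf : IsTestFun f) (a : Euc d) {r : ℝ}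
    (hr : 0 < r) : IsTestFun (rescale a r f) :=
  ⟨hf.1.comp (by fun_prop), hf.2.comp_homeomorph
    ((Homeomorph.subRight a).trans (Homeomorph.smulOfNeZero r⁻¹ (by positivity)))⟩

lemma IsHarmonicOn.setIntegral_rescale_eq {d : ℕ} {a : Euc d} {r : ℝ} (hr : 0 < r)
    {φ : Euc d → ℝ} (hφ : IsHarmonicOn φ (ball a r)) {f F B g : Euc d → ℝ}
    (hF : IsTestFun F) (hFs : tsupport F ⊆ ball 0 1)
    (hB : IsTestFun B) (hBs : tsupport B ⊆ ball 0 1)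
    (hg : IsTestFun g) (hgs : tsupport g ⊆ ball 0 1)
    (hf : ∀ x, f x = lap g x + B x - F x) :
    ∫ x in ball a r, φ x * rescale a r f x =
      (∫ x in ball a r, φ x * rescale a r B x) - ∫ x in ball a r, φ x * rescale a r F x := by
  have hInt {k : Euc d → ℝ} (hk : IsTestFun k) (hks : tsupport k ⊆ ball 0 1) :
      IntegrableOn (fun x => φ x * rescale a r k x) (ball a r) :=
    (integrable_mul_of_tsupport_subset isOpen_ball hφ.1.continuousOn (hk.rescale a hr).1.continuous
      (hk.rescale a hr).2 (tsupport_rescale_subset_ball a hr hks)).integrableOn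
  have hlap (x : Euc d) : rescale a r (_root_.lap g) x = r ^ 2 * _root_.lap (rescale a r g) x := by
    have h := lap_comp_homothety (contDiff_infty.1 hg.1 2) a x r⁻¹
    change _ = r ^ 2 * lap (fun y => g (r⁻¹ • (y - a))) x
    rw [h]
    simp only [rescale]
    field_simp
  have hzero : ∫ x in ball a r, φ x * rescale a r (lap g) x = 0 := by
    simp only [hlap, mul_left_comm _ (r ^ 2)]
    rw [integral_const_mul, hφ.integral_mul_lap_eq_zero isOpen_ball (hg.rescale a hr)
      (tsupport_rescale_subset_ball a hr hgs), mul_zero]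
  have hsplit (x : Euc d) : φ x * rescale a r f x =
      φ x * rescale a r (lap g) x + φ x * rescale a r B x - φ x * rescale a r F x := by
    simp only [rescale, hf]
    ring
  have hgi := hInt hg.lap ((tsupport_lap_subset g).trans hgs)
  have hadd : IntegrableOn (fun x => φ x * rescale a r (lap g) x + φ x * rescale a r B x)
      (ball a r) := hgi.add (hInt hB hBs)
  simp only [hsplit]
  rw [integral_sub hadd (hInt hF hFs), integral_add hgi (hInt hB hBs), hzero,
    zero_add]

/-! ### Second moments of the Markov components -/

lemma GFF.integrable_sq {d : ℕ} {Ω : Type} [MeasurableSpace Ω] (X : GFF d Ω) {f : Euc d → ℝ}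
    (hf : IsTestFun f) : Integrable (fun ω => (X.h 0 1 f ω) ^ 2) X.P := by
  refine ((X.mom4 f hf).add (integrable_const 1)).mono'
    ((X.meas_h 0 1 f).pow_const 2).aestronglyMeasurable (ae_of_all _ fun ω => ?_)
  rw [Real.norm_eq_abs, abs_of_nonneg (sq_nonneg _)]
  change _ ≤ X.h 0 1 f ω ^ 4 + 1
  nlinarith [sq_nonneg (X.h 0 1 f ω ^ 2 - 1)]

lemma IsDMPDecomp.map_rescale {d : ℕ} {Ω : Type} [MeasurableSpace Ω] {X : GFF d Ω} {a : Euc d}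
    {r : ℝ} (hr : 0 < r) {H Φ : (Euc d → ℝ) → Ω → ℝ} {φ : Ω → Euc d → ℝ}
    (hdec : IsDMPDecomp X a r H Φ φ) {f : Euc d → ℝ} (hf : IsTestFun f) :
    X.P.map (H (rescale a r f)) = X.P.map fun ω => r ^ (1 + (d : ℝ) / 2) * X.h 0 1 f ω := by
  have h1 := hdec.2.2.2.2.1 1 (fun _ => rescale a r f) fun _ => hf.rescale a hr
  have h2 := X.scaling a r hr 1 (fun _ => f) fun _ => hf
  have h3 := congrArg (Measure.map fun y : Fin 1 → ℝ => y 0) (h1.trans h2)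
  rwa [Measure.map_map (measurable_pi_apply 0) (measurable_pi_lambda _ fun _ => (hdec.1 _).1),
    Measure.map_map (measurable_pi_apply 0)
      (measurable_pi_lambda _ fun _ => (X.meas_h 0 1 f).const_mul _)] at h3

lemma IsDMPDecomp.integrable_sq {d : ℕ} {Ω : Type} [MeasurableSpace Ω] {X : GFF d Ω} {a : Euc d}
    {r : ℝ} (hr : 0 < r) {H Φ : (Euc d → ℝ) → Ω → ℝ} {φ : Ω → Euc d → ℝ}
    (hdec : IsDMPDecomp X a r H Φ φ) {f : Euc d → ℝ} (hf : IsTestFun f) :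
    Integrable (fun ω => (H (rescale a r f) ω) ^ 2) X.P := by
  have hsq : Measurable fun y : ℝ => y ^ 2 := measurable_id.pow_const 2
  have h := integrable_map_measure (μ := X.P) (g := fun y : ℝ => y ^ 2)
    hsq.aestronglyMeasurable (hdec.1 (rescale a r f)).1.aemeasurable
  refine h.1 ?_
  rw [hdec.map_rescale hr hf, integrable_map_measure hsq.aestronglyMeasurable
    ((X.meas_h 0 1 f).const_mul _).aemeasurable]
  simpa only [Function.comp_def, mul_pow] using (X.integrable_sq hf).const_mul _

lemma IsDMPDecomp.integral_sq {d : ℕ} {Ω : Type} [MeasurableSpace Ω] {X : GFF d Ω} {a : Euc d}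
    {r : ℝ} (hr : 0 < r) {H Φ : (Euc d → ℝ) → Ω → ℝ} {φ : Ω → Euc d → ℝ}
    (hdec : IsDMPDecomp X a r H Φ φ) {f : Euc d → ℝ} (hf : IsTestFun f) :
    ∫ ω, (H (rescale a r f) ω) ^ 2 ∂X.P =
      (r ^ (1 + (d : ℝ) / 2)) ^ 2 * ∫ ω, (X.h 0 1 f ω) ^ 2 ∂X.P := by
  have hsq : Measurable fun y : ℝ => y ^ 2 := measurable_id.pow_const 2
  have h1 := integral_map (μ := X.P) (f := fun y : ℝ => y ^ 2)
    (hdec.1 (rescale a r f)).1.aemeasurable hsq.aestronglyMeasurable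
  rw [← h1, hdec.map_rescale hr hf,
    integral_map ((X.meas_h 0 1 f).const_mul _).aemeasurable hsq.aestronglyMeasurable]
  simp only [mul_pow]
  exact integral_const_mul _ _

/-! ### Uniqueness of the harmonic part -/

lemma ae_setIntegral_eq_of_balayage {d : ℕ} {Ω : Type} [MeasurableSpace Ω] {X : GFF d Ω}
    {a : Euc d} {r : ℝ} (hr : 0 < r) {H₁ Φ₁ H₂ Φ₂ : (Euc d → ℝ) → Ω → ℝ} {φ₁ φ₂ : Ω → Euc d → ℝ}
    (hdec₁ : IsDMPDecomp X a r H₁ Φ₁ φ₁) (hdec₂ : IsDMPDecomp X a r H₂ Φ₂ φ₂)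
    {f : Euc d → ℝ} {F B g : ℕ → Euc d → ℝ} (hf : IsTestFun f) (hfs : tsupport f ⊆ ball 0 1)
    (hF : ∀ n, IsTestFun (F n) ∧ tsupport (F n) ⊆ ball 0 1)
    (hB : ∀ n, IsTestFun (B n) ∧ tsupport (B n) ⊆ ball 0 1)
    (hg : ∀ n, IsTestFun (g n) ∧ tsupport (g n) ⊆ ball 0 1)
    (hfg : ∀ n x, f x = lap (g n) x + B n x - F n x)
    (hF0 : Tendsto (fun n => ∫ ω, (X.h 0 1 (F n) ω) ^ 2 ∂X.P) atTop (𝓝 0))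
    (hB0 : Tendsto (fun n => ∫ ω, (X.h 0 1 (B n) ω) ^ 2 ∂X.P) atTop (𝓝 0)) :
    ∀ᵐ ω ∂X.P, ∫ x in ball a r, φ₁ ω x * rescale a r f x =
      ∫ x in ball a r, φ₂ ω x * rescale a r f x := by
  set T : Ω → ℝ := fun ω => Φ₁ (rescale a r f) ω - Φ₂ (rescale a r f) ω
  have hTm : Measurable T := (hdec₁.1 _).2.sub (hdec₂.1 _).2
  set S : ℕ → Ω → ℝ := fun n ω => 4 * ((H₁ (rescale a r (F n)) ω ^ 2 +
    H₂ (rescale a r (F n)) ω ^ 2) + (H₁ (rescale a r (B n)) ω ^ 2 + H₂ (rescale a r (B n)) ω ^ 2))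
  have hTS (n) : ∀ᵐ ω ∂X.P, T ω ^ 2 ≤ S n ω := by
    filter_upwards [hdec₁.2.2.2.2.2, hdec₂.2.2.2.2.2,
      hdec₁.2.2.1 _ ((hF n).1.rescale a hr), hdec₂.2.2.1 _ ((hF n).1.rescale a hr),
      hdec₁.2.2.1 _ ((hB n).1.rescale a hr), hdec₂.2.2.1 _ ((hB n).1.rescale a hr)]
      with ω h1 h2 hF1 hF2 hB1 hB2
    have hrep {φ : Euc d → ℝ} {Φ : (Euc d → ℝ) → Ω → ℝ} (h : IsHarmonicOn φ (ball a r) ∧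
        ∀ f : Euc d → ℝ, IsTestFun f → tsupport f ⊆ ball a r →
          Φ f ω = ∫ x in ball a r, φ x * f x) :
        Φ (rescale a r f) ω = Φ (rescale a r (B n)) ω - Φ (rescale a r (F n)) ω := by
      rw [h.2 _ (hf.rescale a hr) (tsupport_rescale_subset_ball a hr hfs),
        h.2 _ ((hF n).1.rescale a hr) (tsupport_rescale_subset_ball a hr (hF n).2),
        h.2 _ ((hB n).1.rescale a hr) (tsupport_rescale_subset_ball a hr (hB n).2)]
      exact h.1.setIntegral_rescale_eq hr (hF n).1 (hF n).2 (hB n).1 (hB n).2 (hg n).1 (hg n).2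
        (hfg n)
    have hT : T ω = (H₂ (rescale a r (B n)) ω - H₁ (rescale a r (B n)) ω) -
        (H₂ (rescale a r (F n)) ω - H₁ (rescale a r (F n)) ω) := by
      simp only [T]
      rw [hrep h1, hrep h2]
      linarith
    rw [hT]
    simp only [S]
    generalize H₁ (rescale a r (B n)) ω = p
    generalize H₂ (rescale a r (B n)) ω = q
    generalize H₁ (rescale a r (F n)) ω = s
    generalize H₂ (rescale a r (F n)) ω = t
    nlinarith [sq_nonneg (q + p), sq_nonneg (q + t), sq_nonneg (q - s), sq_nonneg (p - t),
      sq_nonneg (p + s), sq_nonneg (t + s)]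
  have hI₁F (n) := hdec₁.integrable_sq hr (hF n).1
  have hI₂F (n) := hdec₂.integrable_sq hr (hF n).1
  have hI₁B (n) := hdec₁.integrable_sq hr (hB n).1
  have hI₂B (n) := hdec₂.integrable_sq hr (hB n).1
  have hSint (n) : Integrable (S n) X.P :=
    (((hI₁F n).add (hI₂F n)).add ((hI₁B n).add (hI₂B n))).const_mul 4
  have hTint : Integrable (fun ω => T ω ^ 2) X.P := by
    refine (hSint 0).mono' (hTm.pow_const 2).aestronglyMeasurable ?_
    filter_upwards [hTS 0] with ω h
    rwa [Real.norm_eq_abs, abs_of_nonneg (sq_nonneg _)]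
  have hSval (n) : ∫ ω, S n ω ∂X.P = 8 * (r ^ (1 + (d : ℝ) / 2)) ^ 2 *
      (∫ ω, (X.h 0 1 (F n) ω) ^ 2 ∂X.P + ∫ ω, (X.h 0 1 (B n) ω) ^ 2 ∂X.P) := by
    have h1 : Integrable (fun ω => H₁ (rescale a r (F n)) ω ^ 2 +
        H₂ (rescale a r (F n)) ω ^ 2) X.P := (hI₁F n).add (hI₂F n)
    have h2 : Integrable (fun ω => H₁ (rescale a r (B n)) ω ^ 2 +
        H₂ (rescale a r (B n)) ω ^ 2) X.P := (hI₁B n).add (hI₂B n)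
    simp only [S]
    rw [integral_const_mul, integral_add h1 h2,
      integral_add (hI₁F n) (hI₂F n), integral_add (hI₁B n) (hI₂B n),
      hdec₁.integral_sq hr (hF n).1, hdec₂.integral_sq hr (hF n).1,
      hdec₁.integral_sq hr (hB n).1, hdec₂.integral_sq hr (hB n).1]
    ring
  have hlim : Tendsto (fun n => ∫ ω, S n ω ∂X.P) atTop (𝓝 0) := by
    simp only [hSval]
    simpa using (hF0.add hB0).const_mul (8 * (r ^ (1 + (d : ℝ) / 2)) ^ 2)
  have hT0 : ∫ ω, T ω ^ 2 ∂X.P = 0 :=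
    le_antisymm (ge_of_tendsto' hlim fun n => integral_mono_ae hTint (hSint n) (hTS n))
      (integral_nonneg fun ω => sq_nonneg _)
  rw [integral_eq_zero_iff_of_nonneg (fun ω => sq_nonneg _) hTint] at hT0
  filter_upwards [hdec₁.2.2.2.2.2, hdec₂.2.2.2.2.2, hT0] with ω h1 h2 h0
  rw [← h1.2 _ (hf.rescale a hr) (tsupport_rescale_subset_ball a hr hfs),
    ← h2.2 _ (hf.rescale a hr) (tsupport_rescale_subset_ball a hr hfs)]
  exact sub_eq_zero.1 (pow_eq_zero_iff two_ne_zero |>.1 h0)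

/-- A continuous function on a ball vanishes if its integrals against sufficiently many
nonnegative bumps vanish. -/
lemma eqOn_zero_of_setIntegral_rescale_eq_zero {d : ℕ} {a : Euc d} {r : ℝ} (hr : 0 < r)
    {ψ : Euc d → ℝ} (hψ : ContinuousOn ψ (ball a r))
    (h : ∀ w : Euc d, ‖w‖ < 1 → ∀ δ > 0, ∃ (z : Euc d) (ε : ℝ) (f : Euc d → ℝ),
      dist z w + ε < δ ∧ IsTestFun f ∧ tsupport f ⊆ closedBall z ε ∧ tsupport f ⊆ ball 0 1 ∧
        (∀ x, 0 ≤ f x) ∧ (∃ x, f x ≠ 0) ∧ ∫ x in ball a r, ψ x * rescale a r f x = 0) :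
    ∀ y ∈ ball a r, ψ y = 0 := by
  intro y hy
  by_contra hne
  set V : Set (Euc d) := {x ∈ ball a r | 0 < ψ y * ψ x}
  have hV : IsOpen V :=
    (continuousOn_const.mul hψ).isOpen_inter_preimage isOpen_ball isOpen_Ioi
  have hyV : y ∈ V := ⟨hy, mul_self_pos.2 hne⟩
  set w : Euc d := r⁻¹ • (y - a)
  have hw : a + r • w = y := by
    simp only [w]
    rw [smul_inv_smul₀ hr.ne', add_sub_cancel]
  have hw1 : ‖w‖ < 1 := by
    rw [norm_smul, Real.norm_eq_abs, abs_of_pos (inv_pos.2 hr), inv_mul_lt_iff₀ hr, mul_one]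
    exact mem_ball_iff_norm.1 hy
  have hW : IsOpen ((fun v : Euc d => a + r • v) ⁻¹' V) := hV.preimage (by fun_prop)
  obtain ⟨δ, hδ, hball⟩ := Metric.isOpen_iff.1 hW w (by simpa only [mem_preimage, hw] using hyV)
  obtain ⟨z, ε, f, hzε, hf, hfz, hfs, hf0, ⟨x₀, hx₀⟩, hInt⟩ := h w hw1 δ hδ
  have hfW (v : Euc d) (hv : f v ≠ 0) : a + r • v ∈ V := by
    refine hball ?_
    have := hfz (subset_tsupport f hv)
    rw [mem_closedBall] at this
    rw [mem_ball]
    linarith [dist_triangle v z w]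
  have hfV (x : Euc d) (hx : rescale a r f x ≠ 0) : x ∈ V := by
    have := hfW _ hx
    rwa [smul_inv_smul₀ hr.ne', add_sub_cancel] at this
  have hsb := tsupport_rescale_subset_ball a hr hfs
  set q : Euc d → ℝ := fun x => ψ y * (ψ x * rescale a r f x)
  have hqc : Continuous q := continuous_const.mul <|
    (hψ.mul (hf.rescale a hr).1.continuous.continuousOn).continuous_of_tsupport_subset isOpen_ball
      ((tsupport_mul_subset_right (f := ψ) (g := rescale a r f)).trans hsb)
  have hqs : HasCompactSupport q :=
    HasCompactSupport.mul_left (HasCompactSupport.mul_left (hf.rescale a hr).2)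
  have hpos (x : Euc d) (hx : rescale a r f x ≠ 0) : 0 < q x := by
    have h1 := (hfV x hx).2
    have h2 : 0 < rescale a r f x := lt_of_le_of_ne (hf0 _) hx.symm
    simp only [q]
    rw [← mul_assoc]
    positivity
  have hq0 : 0 ≤ q := fun x => by
    by_cases hx : rescale a r f x = 0
    · simp only [q, hx, mul_zero, Pi.zero_apply, le_refl]
    · exact (hpos x hx).le
  have hx₁ : rescale a r f (a + r • x₀) ≠ 0 := by
    simp only [rescale]
    rwa [add_sub_cancel_left, inv_smul_smul₀ hr.ne']
  have hlt := hqc.integral_pos_of_hasCompactSupport_nonneg_nonzero (μ := volume) hqs hq0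
    (hpos _ hx₁).ne'
  simp only [q] at hlt
  rw [integral_const_mul, ← setIntegral_mul_eq_integral hsb, hInt, mul_zero] at hlt
  exact hlt.false

/-- uniqueness of the domain Markov decomposition. -/
theorem statement1 (d : ℕ) (hd : 2 ≤ d) (Ω : Type) [MeasurableSpace Ω] (X : GFF d Ω) (a : Euc d) (r : ℝ) (hr : 0 < r)
    (hsub : ball a r ⊆ ball (0 : Euc d) 1)
    (H₁ Φ₁ H₂ Φ₂ : (Euc d → ℝ) → Ω → ℝ) (φ₁ φ₂ : Ω → Euc d → ℝ)
    (hdec₁ : IsDMPDecomp X a r H₁ Φ₁ φ₁) (hdec₂ : IsDMPDecomp X a r H₂ Φ₂ φ₂) :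
    (∀ᵐ ω ∂X.P, ∀ z ∈ ball a r, φ₁ ω z = φ₂ ω z) ∧
    (∀ f : Euc d → ℝ, IsTestFun f → tsupport f ⊆ ball a r →
      ∀ᵐ ω ∂X.P, H₁ f ω = H₂ f ω) := by
  have hbal (k m : ℕ) (hk : ‖TopologicalSpace.denseSeq (Euc d) k‖ < 1) :=
    X.exists_balayage hd hk (Nat.one_div_pos_of_nat (α := ℝ) (n := m))
  choose f F B g hf hfz hfs hf0 hfne hF hB hg hfg hF0 hB0 using hbal
  have hae : ∀ᵐ ω ∂X.P, ∀ (k m : ℕ) (hk : ‖TopologicalSpace.denseSeq (Euc d) k‖ < 1),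
      ∫ x in ball a r, φ₁ ω x * rescale a r (f k m hk) x =
        ∫ x in ball a r, φ₂ ω x * rescale a r (f k m hk) x := by
    simp only [ae_all_iff]
    exact fun k m hk => ae_setIntegral_eq_of_balayage hr hdec₁ hdec₂ (hf k m hk) (hfs k m hk)
      (hF k m hk) (hB k m hk) (hg k m hk) (hfg k m hk) (hF0 k m hk) (hB0 k m hk)
  have heq : ∀ᵐ ω ∂X.P, ∀ z ∈ ball a r, φ₁ ω z = φ₂ ω z := by
    filter_upwards [hae, hdec₁.2.2.2.2.2, hdec₂.2.2.2.2.2] with ω h h1 h2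
    have hc1 := h1.1.1.continuousOn
    have hc2 := h2.1.1.continuousOn
    suffices hz : ∀ z ∈ ball a r, φ₁ ω z - φ₂ ω z = 0 from fun z hz' => sub_eq_zero.1 (hz z hz')
    refine eqOn_zero_of_setIntegral_rescale_eq_zero hr (hc1.sub hc2) fun w hw δ hδ => ?_
    obtain ⟨m, hm⟩ := exists_nat_one_div_lt (half_pos hδ)
    obtain ⟨_, ⟨hkw, hk⟩, k, rfl⟩ :=
      (TopologicalSpace.denseRange_denseSeq (Euc d)).inter_open_nonempty
        (ball w (δ / 2) ∩ ball 0 1) (isOpen_ball.inter isOpen_ball)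
        ⟨w, mem_ball_self (half_pos hδ), mem_ball_zero_iff.2 hw⟩
    rw [mem_ball_zero_iff] at hk
    rw [mem_ball] at hkw
    have hInt {φ : Euc d → ℝ} (hφ : ContinuousOn φ (ball a r)) :
        IntegrableOn (fun x => φ x * rescale a r (f k m hk) x) (ball a r) :=
      (integrable_mul_of_tsupport_subset isOpen_ball hφ ((hf k m hk).rescale a hr).1.continuous
        ((hf k m hk).rescale a hr).2 (tsupport_rescale_subset_ball a hr (hfs k m hk))).integrableOn
    refine ⟨_, _, f k m hk, by linarith, hf k m hk, hfz k m hk, hfs k m hk, hf0 k m hk,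
      hfne k m hk, ?_⟩
    simp only [sub_mul]
    rw [integral_sub (hInt hc1) (hInt hc2), h k m hk, sub_self]
  refine ⟨heq, fun f hf hfs => ?_⟩
  filter_upwards [heq, hdec₁.2.2.2.2.2, hdec₂.2.2.2.2.2, hdec₁.2.2.1 f hf, hdec₂.2.2.1 f hf]
    with ω h h1 h2 hd1 hd2
  have hΦ : Φ₁ f ω = Φ₂ f ω := by
    rw [h1.2 f hf hfs, h2.2 f hf hfs]
    exact setIntegral_congr_fun measurableSet_ball fun x hx => by simp only [h x hx]
  linarith
end
end

section
/- Under the standing assumptions, for every δ > 0 and z ∈ (1−δ)𝔹 and 0 < ε < δ, the spherical average satisfies the variance bound E[(h_ε(z))²] ≤ C(1 + s(ε)) for a constant C = C(δ, d) depending only on δ and the dimension. -/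
open MeasureTheory ProbabilityTheory Metric Filter Topology Set

noncomputable section

/-- The spherical average `h_ε(z) = φ^{z+ε𝔹}_𝔹(z)`. -/
noncomputable def GFF.sphAvg {d : ℕ} {Ω : Type} [MeasurableSpace Ω] (X : GFF d Ω) (z : Euc d) (ε : ℝ) (ω : Ω) : ℝ :=
  X.φharm z ε ω z

lemma lap_eq_sum_fderiv {d : ℕ} (u : Euc d → ℝ) (x : Euc d) :
    lap u x = ∑ i : Fin d, fderiv ℝ (fderiv ℝ u) x (EuclideanSpace.single i 1)
      (EuclideanSpace.single i 1) := by
  simp [lap, iteratedFDeriv_two_apply]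

/-- The profile of the potential of `radialBump`: it increases from `-1` to `0` on `[0, 1/8]`. -/
def potentialProfile (s : ℝ) : ℝ := Real.smoothTransition (8 * s) - 1

lemma potentialProfile_contDiff {n : ℕ∞} : ContDiff ℝ n potentialProfile := by
  unfold potentialProfile
  exact (Real.smoothTransition.contDiff.comp (by fun_prop)).sub contDiff_const

lemma potentialProfile_of_le {s : ℝ} (hs : 1 / 8 ≤ s) : potentialProfile s = 0 := by
  rw [potentialProfile, Real.smoothTransition.one_of_one_le (by linarith), sub_self]

lemma potentialProfile_monotone : Monotone potentialProfile := fun s t h => by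
  have := Real.smoothTransition.monotone (show 8 * s ≤ 8 * t by linarith)
  simpa [potentialProfile] using this

lemma contDiff_deriv_potentialProfile : ContDiff ℝ (⊤ : ℕ∞) (deriv potentialProfile) :=
  (contDiff_infty_iff_deriv.1 potentialProfile_contDiff).2

/-- A smooth radial function whose gradient is `y ↦ radialBump y • y`. -/
def radialPotential {d : ℕ} (y : Euc d) : ℝ := potentialProfile (‖y‖ ^ 2)

/-- A nonnegative smooth radial bump function supported in the ball of radius `1/2`. -/
def radialBump {d : ℕ} (y : Euc d) : ℝ := 2 * deriv potentialProfile (‖y‖ ^ 2)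

lemma radialPotential_contDiff {d : ℕ} : ContDiff ℝ (⊤ : ℕ∞) (radialPotential (d := d)) :=
  potentialProfile_contDiff.comp (contDiff_norm_sq ℝ)

lemma radialBump_contDiff {d : ℕ} : ContDiff ℝ (⊤ : ℕ∞) (radialBump (d := d)) :=
  contDiff_const.mul (contDiff_deriv_potentialProfile.comp (contDiff_norm_sq ℝ))

lemma radialPotential_of_le {d : ℕ} {y : Euc d} (hy : 1 / 2 ≤ ‖y‖) : radialPotential y = 0 :=
  potentialProfile_of_le (by nlinarith)

lemma radialBump_of_le {d : ℕ} {y : Euc d} (hy : 1 / 2 ≤ ‖y‖) : radialBump y = 0 := by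
  have h : potentialProfile =ᶠ[𝓝 (‖y‖ ^ 2)] fun _ => 0 := by
    filter_upwards [lt_mem_nhds (show (1 / 8 : ℝ) < ‖y‖ ^ 2 by nlinarith)] with s hs
    exact potentialProfile_of_le hs.le
  rw [radialBump, h.deriv_eq, deriv_const, mul_zero]

lemma radialBump_nonneg {d : ℕ} (y : Euc d) : 0 ≤ radialBump y :=
  mul_nonneg zero_le_two potentialProfile_monotone.deriv_nonneg

lemma fderiv_radialPotential {d : ℕ} (y v : Euc d) :
    fderiv ℝ radialPotential y v = radialBump y * inner ℝ y v := by
  have h1 : HasDerivAt potentialProfile (deriv potentialProfile (‖y‖ ^ 2)) (‖y‖ ^ 2) :=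
    ((potentialProfile_contDiff (n := 1)).differentiable (by norm_num) _).hasDerivAt
  have h2 : HasFDerivAt (fun y : Euc d => ‖y‖ ^ 2) (2 • innerSL ℝ y) y :=
    (hasStrictFDerivAt_norm_sq y).hasFDerivAt
  have h3 := h1.comp_hasFDerivAt y h2
  rw [show (radialPotential : Euc d → ℝ) = potentialProfile ∘ fun y => ‖y‖ ^ 2 from rfl,
    h3.fderiv]
  simp [radialBump]
  ring

lemma radialPotential_hasCompactSupport {d : ℕ} :
    HasCompactSupport (radialPotential (d := d)) :=
  HasCompactSupport.intro (isCompact_closedBall 0 (1 / 2)) fun y hy =>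
    radialPotential_of_le (by simpa using (not_le.1 (by simpa using hy) : _ < ‖y‖).le)

lemma tsupport_radialBump_subset {d : ℕ} :
    tsupport (radialBump (d := d)) ⊆ closedBall 0 (1 / 2) :=
  closure_minimal (fun y hy => by
    by_contra h
    exact hy (radialBump_of_le (by simpa using (not_le.1 (by simpa using h) : _ < ‖y‖).le)))
    isClosed_closedBall

lemma radialBump_hasCompactSupport {d : ℕ} : HasCompactSupport (radialBump (d := d)) :=
  (isCompact_closedBall 0 (1 / 2)).of_isClosed_subset (isClosed_tsupport _)
    tsupport_radialBump_subset

lemma radialBump_integrable {d : ℕ} : Integrable (radialBump (d := d)) :=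
  radialBump_contDiff.continuous.integrable_of_hasCompactSupport radialBump_hasCompactSupport

lemma integral_radialBump_pos {d : ℕ} (hd : 0 < d) : 0 < ∫ y : Euc d, radialBump y := by
  obtain ⟨c, hc, hc'⟩ := exists_deriv_eq_slope potentialProfile (a := 0) (b := 1 / 8)
    (by norm_num) (potentialProfile_contDiff (n := 1)).continuous.continuousOn
    ((potentialProfile_contDiff (n := 1)).differentiable (by norm_num)).differentiableOn
  have h8 : deriv potentialProfile c = 8 := by
    rw [hc']; norm_num [potentialProfile]
  refine radialBump_contDiff.continuous.integral_pos_of_hasCompactSupport_nonneg_nonzero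
    radialBump_hasCompactSupport radialBump_nonneg
    (x := EuclideanSpace.single ⟨0, hd⟩ (Real.sqrt c)) ?_
  rw [radialBump, PiLp.norm_single, Real.norm_eq_abs, sq_abs, Real.sq_sqrt hc.1.le, h8]
  norm_num

lemma hasDerivAt_integral_radialBump {d : ℕ} {w : Euc d → ℝ} (hw : ContDiff ℝ 1 w) (a : Euc d)
    (t : ℝ) :
    HasDerivAt (fun t : ℝ => ∫ y, w (a + t • y) * radialBump y)
      (∫ y, fderiv ℝ w (a + t • y) y * radialBump y) t := by
  have hb : Continuous (radialBump (d := d)) := radialBump_contDiff.continuous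
  have hwc : Continuous w := hw.continuous
  have hw' : Continuous (fderiv ℝ w) := hw.continuous_fderiv (by norm_num)
  have hcont : Continuous fun p : ℝ × Euc d => fderiv ℝ w (a + p.1 • p.2) p.2 := by
    exact (hw'.comp (by fun_prop)).clm_apply continuous_snd
  obtain ⟨C, hC⟩ := ((isCompact_closedBall t 1).prod
    (isCompact_closedBall (0 : Euc d) (1 / 2))).exists_bound_of_continuousOn hcont.continuousOn
  refine (hasDerivAt_integral_of_dominated_loc_of_deriv_le
    (F := fun t y => w (a + t • y) * radialBump y)
    (F' := fun t y => fderiv ℝ w (a + t • y) y * radialBump y)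
    (bound := fun y => C * radialBump y)
    (ball_mem_nhds t one_pos) ?_ ?_ ?_ ?_ ?_ ?_).2
  · exact Eventually.of_forall fun τ =>
      ((hwc.comp (by fun_prop)).mul hb).aestronglyMeasurable
  · exact ((hwc.comp (by fun_prop)).mul hb).integrable_of_hasCompactSupport
      radialBump_hasCompactSupport.mul_left
  · exact (((hw'.comp (by fun_prop)).clm_apply continuous_id).mul hb).aestronglyMeasurable
  · refine Eventually.of_forall fun y τ hτ => ?_
    rw [norm_mul, Real.norm_of_nonneg (radialBump_nonneg y)]
    rcases le_total (1 / 2) ‖y‖ with hy | hy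
    · simp [radialBump_of_le hy]
    · exact mul_le_mul_of_nonneg_right
        (hC (τ, y) ⟨ball_subset_closedBall hτ, by simpa using hy⟩) (radialBump_nonneg y)
  · exact radialBump_integrable.const_mul C
  · refine Eventually.of_forall fun y τ _ => ?_
    have h1 : HasDerivAt (fun τ : ℝ => a + τ • y) y τ := by
      simpa using ((hasDerivAt_id τ).smul_const y).const_add a
    exact (((hw.differentiable (by norm_num) _).hasFDerivAt.comp_hasDerivAt τ h1)).mul_const _

lemma integral_fderiv_mul_radialBump_eq_zero {d : ℕ} {w : Euc d → ℝ} (hw : ContDiff ℝ 2 w)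
    {a : Euc d} {t : ℝ} (h : ∀ y, ‖y‖ < 1 / 2 → lap w (a + t • y) = 0) :
    ∫ y, fderiv ℝ w (a + t • y) y * radialBump y = 0 := by
  have hw' : ContDiff ℝ 1 (fderiv ℝ w) := hw.fderiv_right (by norm_num)
  have hG : ContDiff ℝ 1 (radialPotential (d := d)) := radialPotential_contDiff.of_le
    (by exact_mod_cast le_top)
  set e : Fin d → Euc d := fun i => EuclideanSpace.single i 1
  have hD : ∀ i y, HasFDerivAt (fun y => fderiv ℝ w (a + t • y) (e i))
      (((ContinuousLinearMap.apply ℝ ℝ (e i)).comp (fderiv ℝ (fderiv ℝ w) (a + t • y))).comp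
        (t • ContinuousLinearMap.id ℝ (Euc d))) y := fun i y => by
    have h1 : HasFDerivAt (fun y : Euc d => a + t • y) (t • ContinuousLinearMap.id ℝ (Euc d)) y :=
      ((hasFDerivAt_id y).const_smul t).const_add a
    exact ((ContinuousLinearMap.apply ℝ ℝ (e i)).hasFDerivAt.comp _
      (hw'.differentiable (by norm_num) _).hasFDerivAt).comp y h1
  have hc1 : ∀ i, Continuous fun y => fderiv ℝ w (a + t • y) (e i) := fun i =>
    (hw'.continuous.comp (by fun_prop)).clm_apply continuous_const
  have hc2 : ∀ i, Continuous fun y => fderiv ℝ (fderiv ℝ w) (a + t • y) (e i) (e i) := fun i =>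
    (((hw'.continuous_fderiv (by norm_num)).comp (by fun_prop)).clm_apply
      continuous_const).clm_apply continuous_const
  have hGs : HasCompactSupport (radialPotential (d := d)) := radialPotential_hasCompactSupport
  have hi1 : ∀ i, Integrable fun y =>
      fderiv ℝ w (a + t • y) (e i) * fderiv ℝ radialPotential y (e i) := fun i =>
    ((hc1 i).mul ((hG.continuous_fderiv (by norm_num)).clm_apply
      continuous_const)).integrable_of_hasCompactSupport (hGs.fderiv_apply ℝ (e i)).mul_left
  have hi2 : ∀ i, Integrable fun y =>
      t * fderiv ℝ (fderiv ℝ w) (a + t • y) (e i) (e i) * radialPotential y := fun i =>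
    ((continuous_const.mul (hc2 i)).mul hG.continuous).integrable_of_hasCompactSupport
      hGs.mul_left
  have ibp : ∀ i, ∫ y, fderiv ℝ w (a + t • y) (e i) * fderiv ℝ radialPotential y (e i)
      = - ∫ y, t * fderiv ℝ (fderiv ℝ w) (a + t • y) (e i) (e i) * radialPotential y := by
    intro i
    have hfd : ∀ y, fderiv ℝ (fun y => fderiv ℝ w (a + t • y) (e i)) y (e i)
        = t * fderiv ℝ (fderiv ℝ w) (a + t • y) (e i) (e i) := fun y => by
      rw [(hD i y).fderiv]; simp
    have := integral_mul_fderiv_eq_neg_fderiv_mul_of_integrable (μ := volume)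
      (f := fun y => fderiv ℝ w (a + t • y) (e i)) (g := radialPotential (d := d)) (v := e i)
      ?_ ?_ ?_ (fun y _ => (hD i y).differentiableAt)
      (fun y _ => hG.differentiable (by norm_num) y)
    · simpa only [hfd] using this
    · simpa only [hfd] using hi2 i
    · exact hi1 i
    · exact ((hc1 i).mul hG.continuous).integrable_of_hasCompactSupport hGs.mul_left
  have hsum : ∀ y, fderiv ℝ w (a + t • y) y * radialBump y
      = ∑ i, fderiv ℝ w (a + t • y) (e i) * fderiv ℝ radialPotential y (e i) := fun y => by
    have hy : y = ∑ i, y i • e i := by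
      ext j
      simp [e, Finset.sum_apply, Pi.single_apply]
    conv_lhs => rw [show fderiv ℝ w (a + t • y) y = ∑ i, y i * fderiv ℝ w (a + t • y) (e i) by
      conv_lhs => enter [2]; rw [hy]
      simp [map_sum]]
    rw [Finset.sum_mul]
    refine Finset.sum_congr rfl fun i _ => ?_
    rw [fderiv_radialPotential, show inner ℝ y (e i) = y i by
      simp [e, EuclideanSpace.inner_single_right]]
    ring
  simp_rw [hsum]
  rw [integral_finsetSum _ fun i _ => hi1 i]
  simp_rw [ibp]
  rw [Finset.sum_neg_distrib, ← integral_finsetSum _ fun i _ => hi2 i, neg_eq_zero,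
    integral_eq_zero_of_ae]
  refine Eventually.of_forall fun y => ?_
  simp only [Pi.zero_apply]
  rw [← Finset.sum_mul, ← Finset.mul_sum, ← lap_eq_sum_fderiv]
  rcases lt_or_ge ‖y‖ (1 / 2) with hy | hy
  · simp [h y hy]
  · simp [radialPotential_of_le hy]

/-- **Mean value property** against a radial bump for globally `C²` functions. -/
lemma integral_comp_mul_radialBump {d : ℕ} {w : Euc d → ℝ} (hw : ContDiff ℝ 2 w)
    {a : Euc d} {r : ℝ} (hr : 0 < r) (h : ∀ x ∈ ball a (r / 2), lap w x = 0) :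
    ∫ y, w (a + r • y) * radialBump y = w a * ∫ y : Euc d, radialBump y := by
  have hd := hasDerivAt_integral_radialBump (hw.of_le (by norm_num)) a
  have := constant_of_has_deriv_right_zero (a := 0) (b := r)
    (fun t _ => (hd t).continuousAt.continuousWithinAt) (fun t ht => by
      have h0 := integral_fderiv_mul_radialBump_eq_zero hw (a := a) (t := t) fun y hy => h _ (by
        rw [mem_ball, dist_eq_norm, add_sub_cancel_left, norm_smul, Real.norm_of_nonneg ht.1]
        nlinarith [norm_nonneg y, ht.1, ht.2])
      have h1 := (hd t).hasDerivWithinAt (s := Ici t)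
      rwa [h0] at h1) r ⟨hr.le, le_rfl⟩
  simpa [integral_const_mul] using this

/-- **Mean value property** against a radial bump for functions harmonic on a ball. -/
lemma IsHarmonicOn.setIntegral_mul_radialBump {d : ℕ} {u : Euc d → ℝ} {a : Euc d} {r s : ℝ}
    (hu : IsHarmonicOn u (ball a r)) (hs : 0 < s) (hsr : s ≤ r) :
    ∫ x in ball a r, u x * radialBump (s⁻¹ • (x - a))
      = s ^ d * (∫ y : Euc d, radialBump y) * u a := by
  have hr : 0 < r := hs.trans_le hsr
  let χ : ContDiffBump a := ⟨3 / 4 * r, 7 / 8 * r, by positivity, by linarith⟩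
  set w : Euc d → ℝ := fun x => χ x * u x with hwdef
  have hχ : ∀ x ∈ ball a (3 / 4 * r), w =ᶠ[𝓝 x] u := fun x hx => by
    filter_upwards [isOpen_ball.mem_nhds hx] with y hy
    rw [hwdef]
    simp only
    rw [χ.one_of_mem_closedBall (ball_subset_closedBall hy), one_mul]
  have hw : ContDiff ℝ 2 w := by
    rw [contDiff_iff_contDiffAt]
    intro x
    by_cases hx : x ∈ ball a r
    · exact χ.contDiffAt.mul ((hu.1 x hx).contDiffAt (isOpen_ball.mem_nhds hx))
    · have : w =ᶠ[𝓝 x] fun _ => 0 := by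
        have hx' : x ∉ closedBall a (7 / 8 * r) := fun h => hx
          (closedBall_subset_ball (by linarith) h)
        filter_upwards [isClosed_closedBall.isOpen_compl.mem_nhds hx'] with y hy
        rw [hwdef]
        simp only
        rw [χ.zero_of_le_dist (le_of_lt (by simpa using hy)), zero_mul]
      exact contDiffAt_const.congr_of_eventuallyEq this
  have hlap : ∀ x ∈ ball a (s / 2), lap w x = 0 := fun x hx => by
    have hx1 : x ∈ ball a (3 / 4 * r) := ball_subset_ball (by linarith) hx
    rw [lap, (hχ x hx1).iteratedFDeriv ℝ 2 |>.eq_of_nhds]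
    exact hu.2 x (ball_subset_ball (by linarith) hx1)
  have hbump : ∀ x, x ∉ ball a (3 / 4 * r) → radialBump (s⁻¹ • (x - a)) = 0 := fun x hx => by
    apply radialBump_of_le
    rw [norm_smul, norm_inv, Real.norm_of_nonneg hs.le, ← dist_eq_norm, inv_mul_eq_div,
      le_div_iff₀ hs]
    have : 3 / 4 * r ≤ dist x a := by simpa using hx
    linarith
  have hmv := integral_comp_mul_radialBump hw hs hlap
  rw [(hχ a (mem_ball_self (by positivity))).eq_of_nhds] at hmv
  calc ∫ x in ball a r, u x * radialBump (s⁻¹ • (x - a))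
      = ∫ x, u x * radialBump (s⁻¹ • (x - a)) := by
        refine setIntegral_eq_integral_of_forall_compl_eq_zero fun x hx => ?_
        rw [hbump x fun h => hx (ball_subset_ball (by linarith) h), mul_zero]
    _ = ∫ x, w x * radialBump (s⁻¹ • (x - a)) := by
        refine integral_congr_ae (Eventually.of_forall fun x => ?_)
        by_cases hx : x ∈ ball a (3 / 4 * r)
        · simp only [(hχ x hx).eq_of_nhds]
        · simp only [hbump x hx, mul_zero]
    _ = ∫ x, w (a + x) * radialBump (s⁻¹ • x) := by
        rw [← integral_add_left_eq_self _ a]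
        simp
    _ = ∫ x, w (a + s • (s⁻¹ • x)) * radialBump (s⁻¹ • x) := by
        simp [smul_smul, hs.ne']
    _ = s ^ d * ∫ y, w (a + s • y) * radialBump y := by
        rw [Measure.integral_comp_inv_smul_of_nonneg volume
          (fun y => w (a + s • y) * radialBump y) hs.le]
        simp
    _ = _ := by rw [hmv]; ring

lemma IsTestFun.comp_smul_sub {d : ℕ} {f : Euc d → ℝ} (hf : IsTestFun f) {c : ℝ} (hc : c ≠ 0)
    (a : Euc d) : IsTestFun fun x => f (c • (x - a)) := by
  refine ⟨hf.1.comp (by fun_prop), ?_⟩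
  exact hf.2.comp_homeomorph ((Homeomorph.subRight a).trans (Homeomorph.smulOfNeZero c hc))

lemma isTestFun_radialBump {d : ℕ} : IsTestFun (radialBump (d := d)) :=
  ⟨radialBump_contDiff, radialBump_hasCompactSupport⟩

/-- The rescaled radial bump `x ↦ radialBump ((x - z) / s)`. -/
def scaledBump {d : ℕ} (z : Euc d) (s : ℝ) (x : Euc d) : ℝ := radialBump (s⁻¹ • (x - z))

lemma isTestFun_scaledBump {d : ℕ} (z : Euc d) {s : ℝ} (hs : 0 < s) :
    IsTestFun (scaledBump z s) :=
  isTestFun_radialBump.comp_smul_sub (inv_ne_zero hs.ne') z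

lemma tsupport_scaledBump_subset {d : ℕ} (z : Euc d) {s : ℝ} (hs : 0 < s) :
    tsupport (scaledBump z s) ⊆ ball z s :=
  (closure_minimal (fun x hx => by
    by_contra h
    refine hx (radialBump_of_le ?_)
    rw [norm_smul, norm_inv, Real.norm_of_nonneg hs.le, ← dist_eq_norm, inv_mul_eq_div,
      le_div_iff₀ hs]
    have : s / 2 < dist x z := by simpa using h
    linarith) isClosed_closedBall).trans (closedBall_subset_ball (half_lt_self hs))

namespace GFF

variable {d : ℕ} {Ω : Type} [MeasurableSpace Ω] (X : GFF d Ω)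

/-- The second moment of the field on the unit ball tested against `f`. -/
def secondMoment (f : Euc d → ℝ) : ℝ := ∫ ω, (X.h 0 1 f ω) ^ 2 ∂X.P

lemma secondMoment_nonneg (f : Euc d → ℝ) : 0 ≤ X.secondMoment f :=
  integral_nonneg fun _ => sq_nonneg _

lemma memLp_h_unitBall {f : Euc d → ℝ} (hf : IsTestFun f) : MemLp (X.h 0 1 f) 2 X.P := by
  rw [memLp_two_iff_integrable_sq (X.meas_h 0 1 f).aestronglyMeasurable]
  refine ((X.mom4 f hf).add (integrable_const 1)).mono'
    ((X.meas_h 0 1 f).pow_const 2).aestronglyMeasurable (Eventually.of_forall fun ω => ?_)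
  rw [Real.norm_of_nonneg (sq_nonneg _), Pi.add_apply]
  nlinarith [sq_nonneg (X.h 0 1 f ω ^ 2 - 1), sq_nonneg (X.h 0 1 f ω)]

lemma identDistrib_h_comp (a : Euc d) {r : ℝ} (hr : 0 < r) {f : Euc d → ℝ} (hf : IsTestFun f) :
    IdentDistrib (X.h a r fun x => f (r⁻¹ • (x - a)))
      (fun ω => r ^ (1 + (d : ℝ) / 2) * X.h 0 1 f ω) X.P X.P := by
  have h : IdentDistrib (fun ω (_ : Fin 1) => X.h a r (fun x => f (r⁻¹ • (x - a))) ω)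
      (fun ω (_ : Fin 1) => r ^ (1 + (d : ℝ) / 2) * X.h 0 1 f ω) X.P X.P :=
    ⟨(measurable_pi_lambda _ fun _ => X.meas_h _ _ _).aemeasurable,
      (measurable_pi_lambda _ fun _ => (X.meas_h _ _ _).const_mul _).aemeasurable,
      X.scaling a r hr 1 (fun _ => f) fun _ => hf⟩
  exact h.comp (measurable_pi_apply 0)

lemma identDistrib_H {a : Euc d} {r : ℝ} (hr : 0 < r) (hab : ball a r ⊆ ball (0 : Euc d) 1)
    {f : Euc d → ℝ} (hf : IsTestFun f) : IdentDistrib (X.H a r f) (X.h a r f) X.P X.P := by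
  have h : IdentDistrib (fun ω (_ : Fin 1) => X.H a r f ω) (fun ω (_ : Fin 1) => X.h a r f ω)
      X.P X.P :=
    ⟨(measurable_pi_lambda _ fun _ => X.meas_H _ _ _).aemeasurable,
      (measurable_pi_lambda _ fun _ => X.meas_h _ _ _).aemeasurable,
      X.dmp_law a r hr hab 1 (fun _ => f) fun _ => hf⟩
  exact h.comp (measurable_pi_apply 0)

lemma identDistrib_H_comp {a : Euc d} {r : ℝ} (hr : 0 < r)
    (hab : ball a r ⊆ ball (0 : Euc d) 1) {f : Euc d → ℝ} (hf : IsTestFun f) :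
    IdentDistrib (X.H a r fun x => f (r⁻¹ • (x - a)))
      (fun ω => r ^ (1 + (d : ℝ) / 2) * X.h 0 1 f ω) X.P X.P :=
  (X.identDistrib_H hr hab (hf.comp_smul_sub (inv_ne_zero hr.ne') a)).trans
    (X.identDistrib_h_comp a hr hf)

/-- The second moment splits along the domain Markov decomposition. -/
lemma secondMoment_comp {a : Euc d} {r : ℝ} (hr : 0 < r) (hab : ball a r ⊆ ball (0 : Euc d) 1)
    {f : Euc d → ℝ} (hf : IsTestFun f) :
    X.secondMoment (fun x => f (r⁻¹ • (x - a))) = r ^ (d + 2) * X.secondMoment f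
      + ∫ ω, (X.Φ a r (fun x => f (r⁻¹ • (x - a))) ω) ^ 2 ∂X.P := by
  set g : Euc d → ℝ := fun x => f (r⁻¹ • (x - a))
  have hgt : IsTestFun g := hf.comp_smul_sub (inv_ne_zero hr.ne') a
  have hid := X.identDistrib_H_comp hr hab hf
  have hHL : MemLp (X.H a r g) 2 X.P :=
    hid.memLp_iff.2 ((X.memLp_h_unitBall hf).const_mul _)
  have hH0 : ∫ ω, X.H a r g ω ∂X.P = 0 := by
    rw [hid.integral_eq, integral_const_mul, X.centered 0 1 f hf, mul_zero]
  have hdec := X.dmp_decomp a r hr hab g hgt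
  have hΦL : MemLp (X.Φ a r g) 2 X.P := by
    refine ((X.memLp_h_unitBall hgt).sub hHL).ae_eq ?_
    filter_upwards [hdec] with ω hω
    simp [hω]
  have hind : IndepFun (X.H a r g) (X.Φ a r g) X.P := by
    rw [IndepFun_iff_Indep]
    refine indep_of_indep_of_le_left (indep_of_indep_of_le_right (X.dmp_indep a r hr hab) ?_) ?_
    · exact le_sup_of_le_left (le_iSup (fun f : {f : Euc d → ℝ // IsTestFun f} =>
        MeasurableSpace.comap (X.Φ a r f.1) inferInstance) ⟨g, hgt⟩)
    · exact le_iSup (fun f : {f : Euc d → ℝ // IsTestFun f} =>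
        MeasurableSpace.comap (X.H a r f.1) inferInstance) ⟨g, hgt⟩
  have hcross : ∫ ω, X.H a r g ω * X.Φ a r g ω ∂X.P = 0 := by
    have := hind.integral_mul_eq_mul_integral hHL.aestronglyMeasurable hΦL.aestronglyMeasurable
    rw [hH0, zero_mul] at this
    exact this
  have hHsq : ∫ ω, (X.H a r g ω) ^ 2 ∂X.P = r ^ (d + 2) * X.secondMoment f := by
    rw [hid.sq.integral_eq, secondMoment, ← integral_const_mul]
    refine integral_congr_ae (Eventually.of_forall fun ω => ?_)
    simp only [mul_pow]
    rw [← Real.rpow_natCast (r ^ _), ← Real.rpow_mul hr.le, ← Real.rpow_natCast r (d + 2)]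
    congr 2
    push_cast
    ring
  calc X.secondMoment g
      = ∫ ω, ((X.H a r g ω) ^ 2 + (2 * (X.H a r g ω * X.Φ a r g ω) + (X.Φ a r g ω) ^ 2)) ∂X.P := by
        refine integral_congr_ae ?_
        filter_upwards [hdec] with ω hω
        rw [hω]
        ring
    _ = _ := by
        have hi : Integrable (fun ω => 2 * (X.H a r g ω * X.Φ a r g ω)) X.P :=
          (hHL.integrable_mul hΦL).const_mul 2
        have hi' : Integrable (fun ω => 2 * (X.H a r g ω * X.Φ a r g ω) + (X.Φ a r g ω) ^ 2) X.P :=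
          hi.add hΦL.integrable_sq
        rw [integral_add hHL.integrable_sq hi', integral_add hi hΦL.integrable_sq, integral_const_mul, hcross, hHsq]
        ring

lemma le_secondMoment_comp {a : Euc d} {r : ℝ} (hr : 0 < r)
    (hab : ball a r ⊆ ball (0 : Euc d) 1) {f : Euc d → ℝ} (hf : IsTestFun f) :
    r ^ (d + 2) * X.secondMoment f ≤ X.secondMoment (fun x => f (r⁻¹ • (x - a))) := by
  rw [X.secondMoment_comp hr hab hf]
  exact le_add_of_nonneg_right (integral_nonneg fun _ => sq_nonneg _)

/-- The second moment of the harmonic part tested against a radial bump. -/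
lemma integral_sq_Φ_scaledBump {a : Euc d} {r s : ℝ} (hs : 0 < s) (hsr : s ≤ r)
    (hab : ball a r ⊆ ball (0 : Euc d) 1) :
    ∫ ω, (X.Φ a r (scaledBump a s) ω) ^ 2 ∂X.P
      = (s ^ d * ∫ y : Euc d, radialBump y) ^ 2 * ∫ ω, (X.sphAvg a r ω) ^ 2 ∂X.P := by
  rw [← integral_const_mul]
  refine integral_congr_ae ?_
  filter_upwards [X.dmp_harm a r (hs.trans_le hsr) hab] with ω hω
  rw [hω.2 _ (isTestFun_scaledBump a hs)
    ((tsupport_scaledBump_subset a hs).trans (ball_subset_ball hsr))]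
  simp only [scaledBump]
  rw [hω.1.setIntegral_mul_radialBump hs hsr, sphAvg, mul_pow]

/-- The variance of a spherical average is controlled by that of a smooth radial average. -/
lemma integral_sq_sphAvg_le {a : Euc d} {r : ℝ} (hr : 0 < r)
    (hab : ball a r ⊆ ball (0 : Euc d) 1) :
    (r ^ d * ∫ y : Euc d, radialBump y) ^ 2 * ∫ ω, (X.sphAvg a r ω) ^ 2 ∂X.P
      ≤ X.secondMoment (scaledBump a r) := by
  have h := X.secondMoment_comp hr hab (isTestFun_radialBump (d := d))
  rw [← X.integral_sq_Φ_scaledBump hr le_rfl hab]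
  change X.secondMoment (scaledBump a r) = _ + ∫ ω, (X.Φ a r (scaledBump a r) ω) ^ 2 ∂X.P at h
  rw [h]
  exact le_add_of_nonneg_left (mul_nonneg (by positivity) (X.secondMoment_nonneg _))

/-- The second moment of the centered smooth average at scale `s`. -/
def avgMoment (s : ℝ) : ℝ := ((s ^ d)⁻¹) ^ 2 * X.secondMoment (scaledBump 0 s)

lemma avgMoment_nonneg (s : ℝ) : 0 ≤ X.avgMoment s :=
  mul_nonneg (by positivity) (X.secondMoment_nonneg _)

lemma secondMoment_scaledBump_zero {s : ℝ} (hs : 0 < s) :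
    X.secondMoment (scaledBump 0 s) = (s ^ d) ^ 2 * X.avgMoment s := by
  rw [avgMoment]
  field_simp

lemma secondMoment_scaledBump_le {z : Euc d} (hz : ‖z‖ ≤ 1) {ε : ℝ} (hε : 0 < ε) :
    (1 / 2) ^ (d + 2) * X.secondMoment (scaledBump z ε)
      ≤ X.secondMoment (scaledBump 0 (ε / 2)) := by
  have hsub : ball (-(2 : ℝ)⁻¹ • z) (1 / 2) ⊆ ball (0 : Euc d) 1 := by
    refine ball_subset_ball' ?_
    rw [dist_zero_right, norm_smul]
    norm_num
    linarith
  have h := X.le_secondMoment_comp (by norm_num) hsub (isTestFun_scaledBump z hε)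
  convert h using 2
  ext x
  simp only [scaledBump]
  congr 1
  simp only [smul_sub, smul_add, smul_smul, sub_zero, sub_neg_eq_add, neg_smul]
  rw [add_sub_assoc, ← sub_smul]
  match_scalars
  · field_simp
  · norm_num

lemma ball_zero_subset_unitBall {r : ℝ} (hr : r ≤ 1) : ball (0 : Euc d) r ⊆ ball 0 1 :=
  ball_subset_ball hr

lemma scaledBump_zero_comp (s r : ℝ) :
    (fun x : Euc d => scaledBump 0 s (r⁻¹ • (x - 0))) = scaledBump 0 (r * s) := by
  ext x
  simp [scaledBump, smul_smul, mul_comm]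

lemma pow_mul_avgMoment_le {s ρ : ℝ} (hs : 0 < s) (hρ : 0 < ρ) (hρ1 : ρ ≤ 1) :
    ρ ^ (d + 2) * ((s ^ d) ^ 2 * X.avgMoment s) ≤ ((ρ * s) ^ d) ^ 2 * X.avgMoment (ρ * s) := by
  have h := X.le_secondMoment_comp hρ (ball_zero_subset_unitBall hρ1) (isTestFun_scaledBump 0 hs)
  rwa [scaledBump_zero_comp, X.secondMoment_scaledBump_zero hs,
    X.secondMoment_scaledBump_zero (mul_pos hρ hs)] at h

/-- In dimension at least two, variances increase as the scale decreases. -/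
lemma avgMoment_le_of_le (hd : 2 ≤ d) {s t : ℝ} (hs : 0 < s) (hst : s ≤ t) :
    X.avgMoment t ≤ X.avgMoment s := by
  have ht : 0 < t := hs.trans_le hst
  set ρ := s / t with hρ
  have hρ0 : 0 < ρ := div_pos hs ht
  have hρ1 : ρ ≤ 1 := (div_le_one ht).2 hst
  have h := X.pow_mul_avgMoment_le ht hρ0 hρ1
  rw [show ρ * t = s by rw [hρ]; field_simp] at h
  obtain ⟨n, hn⟩ := Nat.exists_eq_add_of_le hd
  have hs' : (s ^ d) ^ 2 = ρ ^ (d + 2) * ρ ^ n * (t ^ d) ^ 2 := by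
    rw [show s = ρ * t by rw [hρ]; field_simp, mul_pow, mul_pow, ← pow_add, ← pow_mul]
    congr 2
    omega
  rw [hs'] at h
  have hc : 0 < ρ ^ (d + 2) * (t ^ d) ^ 2 := by positivity
  have h' : X.avgMoment t ≤ ρ ^ n * X.avgMoment s := by
    refine le_of_mul_le_mul_left ?_ hc
    linarith
  exact h'.trans (mul_le_of_le_one_left (X.avgMoment_nonneg s) (pow_le_one₀ hρ0.le hρ1))

/-- Halving the scale adds an independent increment of variance of order `s ^ (2 - d)`. -/
lemma avgMoment_half_le (hd : 2 ≤ d) {s : ℝ} (hs : 0 < s) (hs1 : s ≤ 1) :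
    X.avgMoment (s / 2) ≤ X.avgMoment (1 / 2) * (s⁻¹) ^ (d - 2) + X.avgMoment s := by
  have hsub := ball_zero_subset_unitBall (d := d) hs1
  have hhalf : s / 2 ≤ s := by linarith
  have h1 := X.secondMoment_comp hs hsub (isTestFun_scaledBump 0 (s := 1 / 2) (by norm_num))
  have h2 := X.integral_sq_sphAvg_le hs hsub
  rw [scaledBump_zero_comp, mul_one_div, X.integral_sq_Φ_scaledBump (half_pos hs) hhalf hsub,
    X.secondMoment_scaledBump_zero (half_pos hs),
    X.secondMoment_scaledBump_zero (by norm_num : (0 : ℝ) < 1 / 2)] at h1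
  rw [X.secondMoment_scaledBump_zero hs] at h2
  have h3 : (∫ y : Euc d, radialBump y) ^ 2 * ∫ ω, (X.sphAvg 0 s ω) ^ 2 ∂X.P ≤ X.avgMoment s := by
    refine le_of_mul_le_mul_left ?_ (show 0 < (s ^ d) ^ 2 by positivity)
    rw [mul_pow] at h2
    linarith
  obtain ⟨n, hn⟩ := Nat.exists_eq_add_of_le hd
  have hdn : d - 2 = n := by omega
  refine le_of_mul_le_mul_left ?_ (show 0 < ((s / 2) ^ d) ^ 2 by positivity)
  have h4 : ((s / 2) ^ d) ^ 2 * (s⁻¹) ^ (d - 2) = s ^ (d + 2) * ((1 / 2) ^ d) ^ 2 := by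
    rw [hdn, hn, inv_pow]
    field_simp
    ring
  calc _ = ((s / 2) ^ d) ^ 2 * (s⁻¹) ^ (d - 2) * X.avgMoment (1 / 2) + ((s / 2) ^ d) ^ 2
        * ((∫ y : Euc d, radialBump y) ^ 2 * ∫ ω, (X.sphAvg 0 s ω) ^ 2 ∂X.P) := by
        rw [h1, h4]; ring
    _ ≤ ((s / 2) ^ d) ^ 2 * (s⁻¹) ^ (d - 2) * X.avgMoment (1 / 2)
        + ((s / 2) ^ d) ^ 2 * X.avgMoment s := by gcongr
    _ = _ := by ring

lemma avgMoment_two_pow_le (hd : 2 ≤ d) (k : ℕ) :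
    X.avgMoment ((2 ^ k)⁻¹) ≤ X.avgMoment 1
      + X.avgMoment (1 / 2) * ∑ j ∈ Finset.range k, ((2 : ℝ) ^ (d - 2)) ^ j := by
  induction k with
  | zero => simp
  | succ k ih =>
    have h := X.avgMoment_half_le hd (s := (2 ^ k)⁻¹) (by positivity)
      (inv_le_one_of_one_le₀ (one_le_pow₀ one_le_two))
    rw [Finset.sum_range_succ, mul_add]
    rw [inv_inv, ← pow_mul, mul_comm k, pow_mul] at h
    rw [show ((2 : ℝ) ^ (k + 1))⁻¹ = (2 ^ k)⁻¹ / 2 by rw [pow_succ, mul_inv]; ring]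
    linarith

end GFF

lemma sum_geom_le_pow {x : ℝ} (hx : 2 ≤ x) (k : ℕ) : ∑ j ∈ Finset.range k, x ^ j ≤ x ^ k := by
  induction k with
  | zero => simp
  | succ k ih =>
    rw [Finset.sum_range_succ, pow_succ]
    nlinarith [pow_pos (zero_lt_two.trans_le hx) k]

lemma sFun_nonneg {d : ℕ} {ε : ℝ} (hε : 0 < ε) (hε1 : ε ≤ 1) : 0 ≤ sFun d ε := by
  unfold sFun
  split_ifs
  · exact neg_nonneg.2 (Real.log_nonpos hε.le hε1)
  · positivity

/-- The dyadic sum of variance increments down to scale `ε` is of order `1 + s(ε)`. -/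
lemma sum_two_pow_le_sFun {d : ℕ} (hd : 2 ≤ d) {ε : ℝ} (hε : 0 < ε) (hε1 : ε ≤ 1) {k : ℕ}
    (hk : 2 ^ k ≤ 4 / ε) :
    ∑ j ∈ Finset.range k, ((2 : ℝ) ^ (d - 2)) ^ j ≤ 4 ^ d * (1 + sFun d ε) := by
  rcases hd.eq_or_lt with rfl | hd3
  · have h1 := Real.log_le_log (by positivity) hk
    rw [Real.log_pow, Real.log_div (by norm_num) hε.ne',
      show Real.log 4 = 2 * Real.log 2 by
        rw [show (4 : ℝ) = 2 ^ 2 by norm_num, Real.log_pow]; norm_num] at h1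
    have h2 := Real.log_two_gt_d9
    have h3 := Real.log_nonpos hε.le hε1
    simp only [le_refl, tsub_eq_zero_of_le, pow_zero, one_pow, Finset.sum_const,
      Finset.card_range, nsmul_eq_mul, mul_one, sFun, if_true]
    nlinarith [(Nat.cast_nonneg k : (0 : ℝ) ≤ k)]
  · obtain ⟨n, rfl⟩ := Nat.exists_eq_add_of_le hd
    have hn : n ≠ 0 := by omega
    rw [Nat.add_sub_cancel_left, sFun, if_neg (by omega)]
    have hs : ε ^ ((2 : ℝ) - ((2 + n : ℕ) : ℝ)) = (ε⁻¹) ^ n := by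
      rw [show (2 : ℝ) - ((2 + n : ℕ) : ℝ) = -(n : ℝ) by push_cast; ring, Real.rpow_neg hε.le,
        Real.rpow_natCast, inv_pow]
    calc ∑ j ∈ Finset.range k, ((2 : ℝ) ^ n) ^ j
        ≤ ((2 : ℝ) ^ n) ^ k := sum_geom_le_pow (le_self_pow₀ one_le_two hn) k
      _ = ((2 : ℝ) ^ k) ^ n := by rw [← pow_mul, ← pow_mul, mul_comm]
      _ ≤ (4 / ε) ^ n := by gcongr
      _ = 4 ^ n * (ε⁻¹) ^ n := by rw [div_eq_mul_inv, mul_pow]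
      _ ≤ 4 ^ (2 + n) * (1 + (ε⁻¹) ^ n) := by
        have : (0 : ℝ) < (ε⁻¹) ^ n := by positivity
        gcongr
        · norm_num
        · omega
        · linarith
      _ = _ := by rw [hs]

/-- the variance bound for spherical averages. -/
theorem statement3 (d : ℕ) (hd : 2 ≤ d) (Ω : Type) [MeasurableSpace Ω] (X : GFF d Ω) (δ : ℝ) (hδ : 0 < δ) :
    ∃ C : ℝ, ∀ (z : Euc d) (ε : ℝ), ‖z‖ < 1 - δ → 0 < ε → ε < δ →
      ∫ ω, (X.sphAvg z ε ω) ^ 2 ∂X.P ≤ C * (1 + sFun d ε) := by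
  set I : ℝ := ∫ y : Euc d, radialBump y with hI
  have hIpos : 0 < I := integral_radialBump_pos (by omega)
  refine ⟨2 ^ (d + 2) / I ^ 2 * (X.avgMoment 1 + X.avgMoment (1 / 2) * 4 ^ d), ?_⟩
  intro z ε hz hε hεδ
  have hz1 : ‖z‖ ≤ 1 := by linarith
  have hε1 : ε ≤ 1 := by linarith [norm_nonneg z]
  have hs := sFun_nonneg (d := d) hε hε1
  have hsub : ball z ε ⊆ ball (0 : Euc d) 1 := ball_subset_ball' (by
    rw [dist_zero_right]; linarith)
  have h1 := X.integral_sq_sphAvg_le hε hsub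
  have h2 := X.secondMoment_scaledBump_le hz1 hε
  rw [X.secondMoment_scaledBump_zero (half_pos hε)] at h2
  have h3 : I ^ 2 * ∫ ω, (X.sphAvg z ε ω) ^ 2 ∂X.P ≤ 2 ^ (d + 2) * X.avgMoment (ε / 2) := by
    refine le_of_mul_le_mul_left ?_ (show 0 < (ε ^ d) ^ 2 by positivity)
    calc _ = (ε ^ d * I) ^ 2 * ∫ ω, (X.sphAvg z ε ω) ^ 2 ∂X.P := by ring
      _ ≤ X.secondMoment (scaledBump z ε) := h1
      _ = 2 ^ (d + 2) * ((1 / 2) ^ (d + 2) * X.secondMoment (scaledBump z ε)) := by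
        rw [← mul_assoc, ← mul_pow]; norm_num
      _ ≤ 2 ^ (d + 2) * (((ε / 2) ^ d) ^ 2 * X.avgMoment (ε / 2)) := by gcongr
      _ ≤ 2 ^ (d + 2) * ((ε ^ d) ^ 2 * X.avgMoment (ε / 2)) := by
        have := X.avgMoment_nonneg (ε / 2)
        gcongr
        linarith
      _ = _ := by ring
  obtain ⟨k, hk1, hk2⟩ := exists_nat_pow_near (x := 2 / ε) (y := (2 : ℝ))
    ((one_le_div hε).2 (by linarith)) one_lt_two
  have h4 : X.avgMoment (ε / 2) ≤ X.avgMoment ((2 ^ (k + 1))⁻¹) :=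
    X.avgMoment_le_of_le hd (by positivity) (by
      rw [inv_le_comm₀ (by positivity) (by positivity), inv_div]; exact hk2.le)
  have h5 := X.avgMoment_two_pow_le hd (k + 1)
  have h6 := sum_two_pow_le_sFun hd hε hε1 (k := k + 1) (by
    rw [pow_succ, show 4 / ε = 2 / ε * 2 by ring]; gcongr)
  have hA := X.avgMoment_nonneg 1
  have hB := X.avgMoment_nonneg (1 / 2)
  have h7 : X.avgMoment (ε / 2)
      ≤ (X.avgMoment 1 + X.avgMoment (1 / 2) * 4 ^ d) * (1 + sFun d ε) :=
    calc _ ≤ X.avgMoment 1 + X.avgMoment (1 / 2) * (4 ^ d * (1 + sFun d ε)) :=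
          h4.trans (h5.trans (by gcongr))
      _ ≤ _ := by nlinarith
  calc _ ≤ 2 ^ (d + 2) * X.avgMoment (ε / 2) / I ^ 2 := by
        rw [le_div_iff₀ (by positivity), mul_comm]; exact h3
    _ ≤ 2 ^ (d + 2) * ((X.avgMoment 1 + X.avgMoment (1 / 2) * 4 ^ d) * (1 + sFun d ε)) / I ^ 2 := by
        gcongr
    _ = _ := by ring
end
end
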